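/- arXiv:math/9803141 — 2 statements merged into one kernel-verified Lean document; each statement's English description precedes it below -/
import Mathlib

section
/- Let g be a finite-dimensional complex semisimple Lie algebra with Cartan subalgebra t, let e ∈ g be a regular nilpotent element, and let x ∈ g be any regular element. For any finite-dimensional g-module V, one has dim_ℂ V^{g^x} ≤ dim_ℂ V^{g^e}; that is, among all regular elements the dimension of the subspace annihilated by the centralizer is maximal at a regular nilpotent. -/
/-!
STATEMENT 6: For a finite-dimensional complex semisimple Lie algebra `g`, a regular nilpotent
element `e ∈ g`, a regular element `x ∈ g`, and any finite-dimensional `g`-module `V`, one has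
`dim V^{g^x} ≤ dim V^{g^e}`.
-/

noncomputable section

open LieAlgebra LieModule Module

/-- The centralizer `g^x = {y ∈ g : ⁅y, x⁆ = 0}` of an element of a Lie algebra, as a Lie
subalgebra. -/
def elementCentralizer (R L : Type*) [CommRing R] [LieRing L] [LieAlgebra R L] (x : L) :
    LieSubalgebra R L :=
  { LinearMap.ker ((ad R L) x) with
    lie_mem' := fun {a b} ha hb => by
      have ha' : ⁅x, a⁆ = 0 := ha
      have hb' : ⁅x, b⁆ = 0 := hb
      show ⁅x, ⁅a, b⁆⁆ = 0
      rw [leibniz_lie, ha', hb']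
      simp }

/-- An element `x` of a Lie algebra is regular when its centralizer has the minimal possible
dimension (which is the rank of the Lie algebra). -/
def IsRegularElement {L : Type*} [LieRing L] [LieAlgebra ℂ L] (x : L) : Prop :=
  ∀ y : L, finrank ℂ (elementCentralizer ℂ L x) ≤ finrank ℂ (elementCentralizer ℂ L y)

/-- For a Lie subalgebra `a ⊆ g` and a `g`-module `V`, the subspace
`V^a = {v ∈ V : a • v = 0}` of vectors annihilated by `a`. -/
def annihilatedBy {R L : Type*} [CommRing R] [LieRing L] [LieAlgebra R L]
    (a : LieSubalgebra R L) (V : Type*) [AddCommGroup V] [Module R V]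
    [LieRingModule L V] [LieModule R L V] : Submodule R V where
  carrier := {v | ∀ y ∈ a, ⁅y, v⁆ = 0}
  add_mem' := fun hm hn => by
    intro y hy
    rw [lie_add, hm y hy, hn y hy, add_zero]
  zero_mem' := fun y _ => lie_zero y
  smul_mem' := fun c v hv => by
    intro y hy
    rw [lie_smul, hv y hy, smul_zero]

section Pencil

variable {K E F : Type*} [Field K] [AddCommGroup E] [Module K E]
  [AddCommGroup F] [Module K F]

/-- The rank of a linear pencil of linear maps drops at only finitely many parameters. -/
theorem LinearMap.finite_finrank_range_add_smul_lt [FiniteDimensional K E] (f g : E →ₗ[K] F) :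
    {t : K | finrank K (f + t • g).range < finrank K f.range}.Finite := by
  obtain ⟨σ, hσ⟩ := f.rangeRestrict.exists_rightInverse_of_surjective f.range_rangeRestrict
  obtain ⟨π, hπ⟩ := f.range.subtype.exists_leftInverse_of_injective (by simp)
  set M : Module.End K f.range := π ∘ₗ g ∘ₗ σ with hM
  refine ((Module.End.finite_hasEigenvalue M).image (fun μ ↦ -μ⁻¹)).subset fun t ht ↦ ?_
  have key : ∀ v, π ((f + t • g) (σ v)) = v + t • M v := by
    intro v
    have h1 : f (σ v) = f.range.subtype v := congrArg Subtype.val (LinearMap.congr_fun hσ v)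
    have h2 := LinearMap.congr_fun hπ v
    simp only [LinearMap.add_apply, LinearMap.smul_apply, map_add, map_smul, h1]
    congr 1
  by_cases hinj : Function.Injective (fun v ↦ v + t • M v)
  · exfalso
    have h3 : Function.Injective ((f + t • g) ∘ₗ σ) := by
      intro v w hvw
      apply hinj
      simp only [← key]
      exact congrArg π hvw
    have h4 := LinearMap.finrank_range_of_inj h3
    have h5 := Submodule.finrank_mono (LinearMap.range_comp_le_range σ (f + t • g))
    simp only [Set.mem_ofPred_eq] at ht
    omega
  · have : ∃ v, v ≠ 0 ∧ v + t • M v = 0 := by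
      by_contra! hcon
      apply hinj
      intro v w hvw
      by_contra hne
      refine hcon (v - w) (sub_ne_zero.mpr hne) ?_
      have hvw' : v + t • M v = w + t • M w := hvw
      rw [map_sub, smul_sub, sub_add_sub_comm, hvw', sub_self]
    obtain ⟨v, hv, hv0⟩ := this
    have ht0 : t ≠ 0 := by
      rintro rfl
      simp [hv] at hv0
    refine ⟨-t⁻¹, ?_, by simp⟩
    refine Module.End.hasEigenvalue_of_hasEigenvector (x := v) ⟨?_, hv⟩
    rw [Module.End.mem_eigenspace_iff, neg_smul, eq_neg_iff_add_eq_zero]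
    have := congrArg (t⁻¹ • ·) hv0
    simpa [smul_smul, ht0, add_comm] using this

theorem LinearMap.finite_finrank_ker_lt_add_smul [FiniteDimensional K E] (f g : E →ₗ[K] F) :
    {t : K | finrank K f.ker < finrank K (f + t • g).ker}.Finite := by
  refine (f.finite_finrank_range_add_smul_lt g).subset fun t ht ↦ ?_
  have h1 := f.finrank_range_add_finrank_ker
  have h2 := (f + t • g).finrank_range_add_finrank_ker
  simp only [Set.mem_ofPred_eq] at ht ⊢
  omega

/-- The kernel of `f ^ 2` as the kernel of a map depending linearly on `f`, up to a constant. -/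
theorem Module.End.finrank_ker_sq_eq (f : Module.End K E) :
    finrank K (LinearMap.ker (((f.comp (LinearMap.fst K E E) - LinearMap.snd K E E).prod
      (f.comp (LinearMap.snd K E E))))) = finrank K (LinearMap.ker (f ^ 2)) := by
  refine LinearEquiv.finrank_eq
    { toFun := fun u ↦ ⟨u.1.1, ?_⟩
      invFun := fun u ↦ ⟨(u.1, f u.1), ?_⟩
      map_add' := fun _ _ ↦ rfl
      map_smul' := fun _ _ ↦ rfl
      left_inv := ?_
      right_inv := fun u ↦ rfl }
  · obtain ⟨⟨u, v⟩, h⟩ := u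
    simp only [LinearMap.mem_ker, LinearMap.prod_apply, Function.prod_apply, Prod.mk_eq_zero,
      LinearMap.sub_apply, LinearMap.comp_apply, LinearMap.fst_apply, LinearMap.snd_apply,
      sub_eq_zero] at h
    rw [LinearMap.mem_ker, pow_two, Module.End.mul_apply]
    simp [h.1, h.2]
  · have : f (f u.1) = 0 := by simpa [pow_two] using LinearMap.mem_ker.mp u.2
    simp [this]
  · rintro ⟨⟨u, v⟩, h⟩
    simp only [LinearMap.mem_ker, LinearMap.prod_apply, Function.prod_apply, Prod.mk_eq_zero,
      LinearMap.sub_apply, LinearMap.comp_apply, LinearMap.fst_apply, LinearMap.snd_apply,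
      sub_eq_zero] at h
    simp [h.1]

theorem Module.End.finite_finrank_ker_sq_lt_add_smul [FiniteDimensional K E]
    (f g : Module.End K E) :
    {t : K | finrank K (LinearMap.ker (f ^ 2)) <
      finrank K (LinearMap.ker ((f + t • g) ^ 2))}.Finite := by
  have := LinearMap.finite_finrank_ker_lt_add_smul
    ((f.comp (LinearMap.fst K E E) - LinearMap.snd K E E).prod (f.comp (LinearMap.snd K E E)))
    ((g.comp (LinearMap.fst K E E)).prod (g.comp (LinearMap.snd K E E)))
  refine this.subset fun t ht ↦ ?_
  simp only [Set.mem_ofPred_eq] at ht ⊢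
  rw [← finrank_ker_sq_eq, ← finrank_ker_sq_eq] at ht
  refine lt_of_lt_of_eq ht (congrArg (fun h : E × E →ₗ[K] E × E ↦ finrank K h.ker) ?_)
  refine LinearMap.ext fun u ↦ Prod.ext ?_ ?_
  · simp only [LinearMap.prod_apply, Function.prod_apply, LinearMap.sub_apply,
      LinearMap.comp_apply, LinearMap.fst_apply, LinearMap.snd_apply, LinearMap.add_apply,
      LinearMap.smul_apply, Prod.fst_add, Prod.smul_fst]
    abel
  · simp

theorem Module.End.finite_not_ker_sq_add_smul_le [FiniteDimensional K E]
    (f g : Module.End K E) (hfg : Commute f g)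
    (hf : IsCompl f.ker f.range) :
    {t : K | ¬ LinearMap.ker ((f + t • g) ^ 2) ≤ f.ker}.Finite := by
  refine (LinearMap.finite_finrank_ker_lt_add_smul (f * f) (g * f)).subset fun t ht ↦ ?_
  by_contra hlt
  apply ht
  simp only [Set.mem_ofPred_eq, not_lt] at hlt
  have hff : LinearMap.ker (f * f) = f.ker := by
    apply le_antisymm
    · intro v hv
      have : f v ∈ f.ker ⊓ f.range := ⟨hv, v, rfl⟩
      rwa [hf.inf_eq_bot] at this
    · intro v hv
      simp [LinearMap.mem_ker.mp hv]
  set A := f + t • g with hA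
  have hAf : Commute f A := (Commute.refl f).add_right (hfg.smul_right t)
  have hker : LinearMap.ker (A * f) = f.ker := by
    symm
    apply Submodule.eq_of_le_of_finrank_le
    · intro v hv
      simp [LinearMap.mem_ker.mp hv]
    · rw [← hff, hA, add_mul, smul_mul_assoc]
      exact hlt
  have hinj : ∀ b ∈ f.range, A b = 0 → b = 0 := by
    rintro _ ⟨u, rfl⟩ hu
    have : u ∈ LinearMap.ker (A * f) := hu
    rwa [hker] at this
  have hker' : ∀ a, f a = 0 → f (A a) = 0 := fun a ha ↦ by
    rw [← Module.End.mul_apply, hAf.eq, Module.End.mul_apply, ha, map_zero]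
  have hran : ∀ b ∈ f.range, A b ∈ f.range := by
    rintro _ ⟨u, rfl⟩
    exact ⟨A u, by rw [← Module.End.mul_apply, hAf.eq, Module.End.mul_apply]⟩
  intro v hv
  obtain ⟨a, ha, b, hb, rfl⟩ := Submodule.mem_sup.mp
    (hf.sup_eq_top ▸ Submodule.mem_top : v ∈ f.ker ⊔ f.range)
  have h0 : A (A a) + A (A b) = 0 := by
    rw [LinearMap.mem_ker, pow_two, Module.End.mul_apply, map_add, map_add] at hv
    exact hv
  have h1 : A (A b) ∈ f.ker ⊓ f.range := by
    refine ⟨?_, hran _ (hran _ hb)⟩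
    rw [eq_neg_of_add_eq_zero_right h0]
    exact neg_mem (hker' _ (hker' _ ha))
  rw [hf.inf_eq_bot] at h1
  have h2 := hinj b hb (hinj _ (hran _ hb) h1)
  simpa [h2] using ha

theorem Module.End.apply_mem_maxGenEigenspace_add_one {D N : Module.End K E}
    (h : D * N = N * D + N) {μ : K} {v : E} (hv : v ∈ D.maxGenEigenspace μ) :
    N v ∈ D.maxGenEigenspace (μ + 1) := by
  rw [Module.End.mem_maxGenEigenspace] at hv ⊢
  obtain ⟨k, hk⟩ := hv
  refine ⟨k, ?_⟩
  have hs : SemiconjBy N (D - μ • 1) (D - (μ + 1) • 1) := by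
    simp only [SemiconjBy, mul_sub, sub_mul, h, add_smul, one_smul, add_mul, smul_mul_assoc,
      mul_smul_comm, mul_one, one_mul]
    abel
  rw [← Module.End.mul_apply, ← (hs.pow_right k).eq, Module.End.mul_apply, hk, map_zero]

/-- If `[D, N] = N` on an invariant subspace `W`, then the generalized kernel of `D` on `W` is no
larger than the kernel of `N` on `W`. -/
theorem Module.End.finrank_ker_sq_inf_le [FiniteDimensional K E] [CharZero K] {D N : Module.End K E}
    (h : D * N = N * D + N) (W : Submodule K E) (hN : ∀ v ∈ W, N v ∈ W) :
    finrank K ↥(LinearMap.ker (D ^ 2) ⊓ W) ≤ finrank K ↥(LinearMap.ker N ⊓ W) := by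
  let m : ℕ → Submodule K E := fun k ↦ D.maxGenEigenspace (k : K) ⊓ W
  set q := ⨆ k, m (k + 1) with hq
  have hdis : Disjoint (m 0) q := by
    have h1 := D.independent_maxGenEigenspace (0 : K)
    refine Disjoint.mono (by simp [m]) ?_ h1
    refine iSup_le fun k ↦ ?_
    refine inf_le_left.trans ?_
    exact le_iSup₂_of_le ((k + 1 : ℕ) : K) (Nat.cast_ne_zero.mpr (Nat.succ_ne_zero k)) le_rfl
  have hmap : (m 0 ⊔ q).map N ≤ q := by
    have : m 0 ⊔ q = ⨆ k, m k := sup_iSup_nat_succ m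
    rw [this, Submodule.map_iSup]
    refine iSup_le fun k ↦ ?_
    rintro _ ⟨v, hv, rfl⟩
    refine Submodule.mem_iSup_of_mem k ⟨?_, hN v hv.2⟩
    simpa using apply_mem_maxGenEigenspace_add_one h hv.1
  have h0 : LinearMap.ker (D ^ 2) ⊓ W ≤ m 0 := by
    refine inf_le_inf_right _ fun v hv ↦ ?_
    rw [Module.End.mem_maxGenEigenspace]
    exact ⟨2, by simpa using hv⟩
  have hW : m 0 ⊔ q ≤ W := sup_le inf_le_right (iSup_le fun k ↦ inf_le_right)
  have h2 := (N.domRestrict (m 0 ⊔ q)).finrank_range_add_finrank_ker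
  rw [LinearMap.range_domRestrict] at h2
  have h3 := Submodule.finrank_mono hmap
  have h4 := Submodule.finrank_sup_add_finrank_inf_eq (m 0) q
  rw [hdis.eq_bot, finrank_bot] at h4
  have h5 : finrank K (N.domRestrict (m 0 ⊔ q)).ker ≤ finrank K ↥(LinearMap.ker N ⊓ W) := by
    rw [← LinearEquiv.finrank_eq (Submodule.equivMapOfInjective (m 0 ⊔ q).subtype
      (Submodule.injective_subtype _) (N.domRestrict (m 0 ⊔ q)).ker).symm]
    refine Submodule.finrank_mono ?_
    rintro _ ⟨v, hv, rfl⟩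
    exact ⟨hv, hW v.2⟩
  have h6 := Submodule.finrank_mono h0
  omega

end Pencil

section Exp

variable {E F : Type*} [AddCommGroup E] [Module ℂ E] [FiniteDimensional ℂ E]
  [AddCommGroup F] [Module ℂ F] [FiniteDimensional ℂ F]

open scoped Matrix.Norms.Operator in
theorem Matrix.mul_exp_eq_exp_mul {m n : Type*} [Fintype m] [DecidableEq m] [Fintype n]
    [DecidableEq n] {A : Matrix n n ℂ} {B : Matrix m m ℂ} {P : Matrix m n ℂ} (h : P * A = B * P) :
    P * NormedSpace.exp A = NormedSpace.exp B * P := by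
  have hpow : ∀ k : ℕ, P * A ^ k = B ^ k * P := by
    intro k
    induction k with
    | zero => simp
    | succ k ih => rw [pow_succ, ← Matrix.mul_assoc, ih, Matrix.mul_assoc, h, pow_succ,
        Matrix.mul_assoc]
  have hA := NormedSpace.exp_series_hasSum_exp' (𝕂 := ℂ) A
  have hB := NormedSpace.exp_series_hasSum_exp' (𝕂 := ℂ) B
  have h1 := hA.map (AddMonoidHom.mk' (fun M : Matrix n n ℂ ↦ P * M) (Matrix.mul_add P))
    (continuous_const.matrix_mul continuous_id)
  have h2 := hB.map (AddMonoidHom.mk' (fun M : Matrix m m ℂ ↦ M * P)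
    (fun M N ↦ Matrix.add_mul M N P)) (continuous_id.matrix_mul continuous_const)
  refine h1.unique ?_
  convert h2 using 1
  · funext k
    simp [hpow]
  · rfl

/-- The exponential of an endomorphism of a finite-dimensional complex vector space. -/
noncomputable def Module.End.exp (A : End ℂ E) : End ℂ E :=
  (LinearMap.toMatrixAlgEquiv (finBasis ℂ E)).symm
    (NormedSpace.exp (LinearMap.toMatrixAlgEquiv (finBasis ℂ E) A))

namespace Module.End

theorem toMatrix_exp (A : End ℂ E) :
    LinearMap.toMatrix (finBasis ℂ E) (finBasis ℂ E) A.exp =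
      NormedSpace.exp (LinearMap.toMatrix (finBasis ℂ E) (finBasis ℂ E) A) :=
  (LinearMap.toMatrixAlgEquiv (finBasis ℂ E)).apply_symm_apply _

theorem comp_exp {A : End ℂ E} {B : End ℂ F} {P : E →ₗ[ℂ] F} (h : P ∘ₗ A = B ∘ₗ P) :
    P ∘ₗ A.exp = B.exp ∘ₗ P := by
  apply (LinearMap.toMatrix (finBasis ℂ E) (finBasis ℂ F)).injective
  rw [LinearMap.toMatrix_comp _ (finBasis ℂ E), LinearMap.toMatrix_comp _ (finBasis ℂ F)]
  rw [toMatrix_exp, toMatrix_exp]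
  apply Matrix.mul_exp_eq_exp_mul
  rw [← LinearMap.toMatrix_comp, ← LinearMap.toMatrix_comp, h]

theorem apply_exp {A : End ℂ E} {B : End ℂ F} {P : E →ₗ[ℂ] F} (h : ∀ v, P (A v) = B (P v))
    (v : E) : P (A.exp v) = B.exp (P v) :=
  LinearMap.congr_fun (comp_exp (LinearMap.ext h)) v

theorem exp_add_of_commute {A B : End ℂ E} (h : Commute A B) : (A + B).exp = A.exp * B.exp := by
  rw [Module.End.exp, map_add, Matrix.exp_add_of_commute _ _ (h.map _), map_mul]
  rfl

theorem exp_zero : (0 : End ℂ E).exp = 1 := by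
  simp [Module.End.exp]

theorem exp_smul_one (c : ℂ) : (c • 1 : End ℂ E).exp = Complex.exp c • 1 := by
  rw [Module.End.exp, map_smul, map_one, ← Matrix.diagonal_one, ← Matrix.diagonal_smul,
    Matrix.exp_diagonal]
  apply (LinearMap.toMatrixAlgEquiv (finBasis ℂ E)).injective
  rw [AlgEquiv.apply_symm_apply, map_smul, map_one, ← Matrix.diagonal_one, ← Matrix.diagonal_smul]
  congr 1
  funext i
  simp [Pi.coe_exp, Complex.exp_eq_exp_ℂ]

theorem exp_apply_of_apply_eq_smul {A : End ℂ E} {v : E} {c : ℂ} (h : A v = c • v) :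
    A.exp v = Complex.exp c • v := by
  have := apply_exp (A := (c • 1 : End ℂ ℂ)) (B := A) (P := LinearMap.toSpanSingleton ℂ E v)
    (fun t ↦ by simp [h, smul_smul, mul_comm]) 1
  rw [exp_smul_one] at this
  simpa using this.symm

theorem exp_apply_of_apply_eq_zero {A : End ℂ E} {v : E} (h : A v = 0) : A.exp v = v := by
  simpa using exp_apply_of_apply_eq_smul (c := 0) (by simpa using h)

/-- The exponential of an endomorphism as a linear equivalence. -/
noncomputable def expEquiv (A : End ℂ E) : E ≃ₗ[ℂ] E :=
  LinearEquiv.ofLinearMap A.exp (-A).exp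
    (by rw [← mul_eq_comp, ← exp_add_of_commute (Commute.refl A).neg_right, add_neg_cancel,
      exp_zero]; rfl)
    (by rw [← mul_eq_comp, ← exp_add_of_commute (Commute.refl A).neg_left, neg_add_cancel,
      exp_zero]; rfl)

theorem exp_apply_sub_mem {A : End ℂ E} {N : Submodule ℂ E} (hN : ∀ v ∈ N, A v ∈ N) {v : E}
    (hv : A v ∈ N) : A.exp v - v ∈ N := by
  have := apply_exp (A := A) (B := N.mapQ N A hN) (P := N.mkQ) (fun v ↦ rfl) v
  have h0 : N.mapQ N A hN (N.mkQ v) = 0 := (Submodule.Quotient.mk_eq_zero N).mpr hv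
  exact (Submodule.Quotient.eq N).mp (this.trans (exp_apply_of_apply_eq_zero h0))

end Module.End

open scoped TensorProduct in
theorem LieModule.exp_toEnd_lie {g V : Type*} [LieRing g] [LieAlgebra ℂ g] [FiniteDimensional ℂ g]
    [AddCommGroup V] [Module ℂ V] [LieRingModule g V] [LieModule ℂ g V] [FiniteDimensional ℂ V]
    (x y : g) (v : V) :
    (toEnd ℂ g V x).exp ⁅y, v⁆ = ⁅(ad ℂ g x).exp y, (toEnd ℂ g V x).exp v⁆ := by
  set a := ad ℂ g x
  set b := toEnd ℂ g V x
  set P : g ⊗[ℂ] V →ₗ[ℂ] V := (toModuleHom ℂ g V : g ⊗[ℂ] V →ₗ[ℂ] V) with hP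
  have hcomm : Commute (TensorProduct.map a 1) (TensorProduct.map (1 : End ℂ g) b) := by
    refine TensorProduct.ext' fun y v ↦ ?_
    simp
  have h1 := Module.End.apply_exp (A := TensorProduct.map a 1 + TensorProduct.map 1 b) (B := b)
    (P := P) (fun t ↦ ?_) (y ⊗ₜ v)
  · have h2 := Module.End.apply_exp (A := b) (B := TensorProduct.map (1 : End ℂ g) b)
      (P := TensorProduct.mk ℂ g V y) (fun v ↦ rfl) v
    have h3 := Module.End.apply_exp (A := a) (B := TensorProduct.map a (1 : End ℂ V))
      (P := (TensorProduct.mk ℂ g V).flip (b.exp v)) (fun v ↦ rfl) y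
    rw [Module.End.exp_add_of_commute hcomm, Module.End.mul_apply] at h1
    simp only [TensorProduct.mk_apply, LinearMap.flip_apply] at h2 h3
    rw [← h2, ← h3] at h1
    simpa [hP] using h1.symm
  · induction t with
    | zero => simp
    | add s t hs ht => rw [map_add, map_add, hs, ht, map_add, map_add]
    | tmul y v => simp [hP, a, b]

end Exp

section Lifts

variable {g : Type*} [LieRing g] [LieAlgebra ℂ g]
  (V : Type*) [AddCommGroup V] [Module ℂ V] [LieRingModule g V]

/-- A Lie algebra automorphism `φ` lifts to the module `V` if the twist of `V` by `φ` is isomorphic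
to `V`. -/
def LieEquiv.Lifts (φ : g ≃ₗ⁅ℂ⁆ g) : Prop :=
  ∃ T : V ≃ₗ[ℂ] V, ∀ (y : g) (v : V), T ⁅y, v⁆ = ⁅φ y, T v⁆

variable {V}

theorem LieEquiv.Lifts.refl : (LieEquiv.refl : g ≃ₗ⁅ℂ⁆ g).Lifts V :=
  ⟨LinearEquiv.refl ℂ V, fun _ _ ↦ rfl⟩

theorem LieEquiv.Lifts.trans {φ ψ : g ≃ₗ⁅ℂ⁆ g} (hφ : φ.Lifts V) (hψ : ψ.Lifts V) :
    (φ.trans ψ).Lifts V := by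
  obtain ⟨T, hT⟩ := hφ
  obtain ⟨S, hS⟩ := hψ
  exact ⟨T.trans S, fun y v ↦ by simp [hT, hS]⟩

theorem LieEquiv.Lifts.symm {φ : g ≃ₗ⁅ℂ⁆ g} (hφ : φ.Lifts V) : φ.symm.Lifts V := by
  obtain ⟨T, hT⟩ := hφ
  refine ⟨T.symm, fun y v ↦ ?_⟩
  rw [LinearEquiv.symm_apply_eq, hT]
  simp

variable [FiniteDimensional ℂ g]

/-- The inner automorphism `exp (ad x)`. -/
noncomputable def LieAlgebra.expAd (x : g) : g ≃ₗ⁅ℂ⁆ g :=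
  { (ad ℂ g x).expEquiv with
    map_lie' := fun {y z} ↦ LieModule.exp_toEnd_lie (V := g) x y z }

@[simp] theorem LieAlgebra.expAd_apply (x y : g) : expAd x y = (ad ℂ g x).exp y := rfl

theorem LieAlgebra.lifts_expAd [LieModule ℂ g V] [FiniteDimensional ℂ V] (x : g) :
    (expAd x).Lifts V :=
  ⟨(toEnd ℂ g V x).expEquiv, fun y v ↦ LieModule.exp_toEnd_lie x y v⟩

end Lifts

section LocalSurjectivity

open Filter Topology

open scoped Matrix.Norms.Operator in
theorem Matrix.eventually_exists_exp_mulVec_eq {p n m : ℕ}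
    (M : (Fin p → ℂ) →ₗ[ℂ] Matrix (Fin n) (Fin n) ℂ) (L : (Fin p → ℂ) →ₗ[ℂ] (Fin n → ℂ))
    (Q : (Fin n → ℂ) →ₗ[ℂ] (Fin m → ℂ)) (x : Fin n → ℂ)
    (h : ∀ u, ∃ v, Q (Matrix.toLin' (M v) x + L v) = u) (u : Fin m → ℂ) :
    ∀ᶠ t : ℂ in 𝓝 0, ∃ v, Q (Matrix.toLin' (NormedSpace.exp (M v)) (x + L v)) = Q x + t • u := by
  set β := (Matrix.toLin' (R := ℂ) (m := Fin n) (n := Fin n)).toLinearMap.toContinuousBilinearMap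
  have hM : HasStrictFDerivAt (fun v ↦ NormedSpace.exp (M v)) M.toContinuousLinearMap 0 := by
    have h1 : HasStrictFDerivAt (NormedSpace.exp : Matrix (Fin n) (Fin n) ℂ → _)
        (1 : Matrix (Fin n) (Fin n) ℂ →L[ℂ] Matrix (Fin n) (Fin n) ℂ)
        (M.toContinuousLinearMap 0) := by
      rw [map_zero]
      exact hasStrictFDerivAt_exp_zero
    exact h1.comp 0 M.toContinuousLinearMap.hasStrictFDerivAt
  have hL : HasStrictFDerivAt (fun v ↦ x + L v) L.toContinuousLinearMap 0 :=
    L.toContinuousLinearMap.hasStrictFDerivAt.const_add x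
  have hF := Q.toContinuousLinearMap.hasStrictFDerivAt.comp 0
    (β.hasStrictFDerivAt_of_bilinear hM hL)
  have hmap := hF.map_nhds_eq_of_surj (by
    refine LinearMap.range_eq_top.mpr fun u ↦ ?_
    obtain ⟨v, rfl⟩ := h u
    refine ⟨v, ?_⟩
    change Q (β (NormedSpace.exp (M 0)) (L v) + β (M v) (x + L 0)) = _
    simp [β, add_comm])
  have h0 : Q.toContinuousLinearMap (β (NormedSpace.exp (M 0)) (x + L 0)) = Q x := by
    simp [β]
  replace hmap := hmap.trans (congrArg 𝓝 h0)
  have ht : Tendsto (fun t : ℂ ↦ Q x + t • u) (𝓝 0) (𝓝 (Q x)) := by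
    have : Continuous fun t : ℂ ↦ Q x + t • u := by fun_prop
    simpa using this.tendsto 0
  have hr := image_mem_map (m := fun v ↦ Q.toContinuousLinearMap
    (β (NormedSpace.exp (M v)) (x + L v))) (univ_mem (f := 𝓝 (0 : Fin p → ℂ)))
  replace hr := hmap.ge hr
  filter_upwards [ht hr] with t ht'
  obtain ⟨v, -, hv⟩ := ht'
  exact ⟨v, hv⟩

theorem Module.End.eventually_exists_exp_apply_eq {P E G : Type*}
    [AddCommGroup P] [Module ℂ P] [FiniteDimensional ℂ P]
    [AddCommGroup E] [Module ℂ E] [FiniteDimensional ℂ E]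
    [AddCommGroup G] [Module ℂ G] [FiniteDimensional ℂ G]
    (M : P →ₗ[ℂ] End ℂ E) (L : P →ₗ[ℂ] E) (Q : E →ₗ[ℂ] G) (x : E)
    (h : ∀ u, ∃ v, Q (M v x + L v) = u) (u : G) :
    ∀ᶠ t : ℂ in 𝓝 0, ∃ v, Q ((M v).exp (x + L v)) = Q x + t • u := by
  set bP := (finBasis ℂ P).equivFun
  set bE := (finBasis ℂ E).equivFun
  set bG := (finBasis ℂ G).equivFun
  set μ := LinearMap.toMatrixAlgEquiv (finBasis ℂ E)
  have hμ : ∀ (C : End ℂ E) (v : E), Matrix.toLin' (μ C) (bE v) = bE (C v) := fun C v ↦ by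
    rw [Matrix.toLin'_apply]
    exact LinearMap.toMatrix_mulVec_repr (finBasis ℂ E) (finBasis ℂ E) C v
  have hμexp : ∀ C : End ℂ E, NormedSpace.exp (μ C) = μ C.exp := fun C ↦ (toMatrix_exp C).symm
  have := Matrix.eventually_exists_exp_mulVec_eq
    (μ.toLinearMap ∘ₗ M ∘ₗ bP.symm.toLinearMap) (bE.toLinearMap ∘ₗ L ∘ₗ bP.symm.toLinearMap)
    (bG.toLinearMap ∘ₗ Q ∘ₗ bE.symm.toLinearMap) (bE x) (fun u ↦ ?_) (bG u)
  · filter_upwards [this] with t ht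
    obtain ⟨v, hv⟩ := ht
    refine ⟨bP.symm v, bG.injective ?_⟩
    simp only [LinearMap.comp_apply, LinearEquiv.coe_coe, AlgEquiv.toLinearMap_apply, hμexp] at hv
    rw [← map_add, hμ] at hv
    simpa using hv
  · obtain ⟨v, hv⟩ := h (bG.symm u)
    refine ⟨bP v, ?_⟩
    simp only [LinearMap.comp_apply, LinearEquiv.coe_coe, AlgEquiv.toLinearMap_apply, hμ,
      LinearEquiv.symm_apply_apply]
    rw [← map_add, LinearEquiv.symm_apply_apply, hv, LinearEquiv.apply_symm_apply]

theorem LieAlgebra.eventually_exists_expAd_apply_eq {g : Type*} [LieRing g] [LieAlgebra ℂ g]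
    [FiniteDimensional ℂ g] {A W N : Submodule ℂ g} {x : g} (hWN : W ≤ N)
    (hx : ∀ y ∈ A, ∀ w ∈ W, ⁅y, x + w⁆ ∈ N) (hN : ∀ y ∈ A, ∀ n ∈ N, ⁅y, n⁆ ∈ N)
    (hsurj : ∀ n ∈ N, ∃ y ∈ A, ∃ w ∈ W, ⁅y, x⁆ + w = n) {u : g} (hu : u ∈ N) :
    ∀ᶠ t : ℂ in 𝓝 0, ∃ y ∈ A, ∃ w ∈ W, expAd y (x + w) = x + t • u := by
  obtain ⟨Q, hQ⟩ := N.subtype.exists_leftInverse_of_injective N.ker_subtype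
  have hQ' : ∀ n (hn : n ∈ N), Q n = ⟨n, hn⟩ := fun n hn ↦ LinearMap.congr_fun hQ ⟨n, hn⟩
  have := Module.End.eventually_exists_exp_apply_eq (P := A × W)
    ((ad ℂ g : g →ₗ[ℂ] Module.End ℂ g) ∘ₗ A.subtype ∘ₗ LinearMap.fst ℂ A W)
    (W.subtype ∘ₗ LinearMap.snd ℂ A W) Q x (fun n ↦ ?_) ⟨u, hu⟩
  · filter_upwards [this] with t ht
    obtain ⟨⟨⟨y, hy⟩, ⟨w, hw⟩⟩, hv⟩ := ht
    refine ⟨y, hy, w, hw, ?_⟩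
    simp only [LinearMap.comp_apply, LinearMap.fst_apply, LinearMap.snd_apply,
      Submodule.subtype_apply, LieHom.coe_toLinearMap] at hv
    have hmem : (ad ℂ g y).exp (x + w) - x ∈ N := by
      have := N.add_mem (Module.End.exp_apply_sub_mem (A := ad ℂ g y) (hN y hy) (hx y hy w hw))
        (hWN hw)
      convert this using 1
      abel
    rw [← sub_eq_iff_eq_add', ← map_sub, hQ' _ hmem] at hv
    have := congrArg Subtype.val hv
    rw [expAd_apply, ← sub_eq_iff_eq_add']
    exact this
  · obtain ⟨y, hy, w, hw, h⟩ := hsurj n n.2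
    refine ⟨⟨⟨y, hy⟩, ⟨w, hw⟩⟩, ?_⟩
    have : Q (⁅y, x⁆ + w) = n := by rw [h, hQ' n n.2]
    exact this

end LocalSurjectivity

section Transport

variable {g : Type*} [LieRing g] [LieAlgebra ℂ g]
  {V : Type*} [AddCommGroup V] [Module ℂ V] [LieRingModule g V] [LieModule ℂ g V]

theorem mem_elementCentralizer_iff {x y : g} : y ∈ elementCentralizer ℂ g x ↔ ⁅x, y⁆ = 0 := Iff.rfl

theorem mem_annihilatedBy_elementCentralizer_iff {x : g} {v : V} :
    v ∈ annihilatedBy (elementCentralizer ℂ g x) V ↔ ∀ y : g, ⁅x, y⁆ = 0 → ⁅y, v⁆ = 0 := Iff.rfl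

theorem LieEquiv.map_ker_ad (φ : g ≃ₗ⁅ℂ⁆ g) (y : g) :
    (LinearMap.ker (ad ℂ g y)).map (φ : g ≃ₗ[ℂ] g).toLinearMap = LinearMap.ker (ad ℂ g (φ y)) := by
  ext z
  simp only [Submodule.mem_map, LinearMap.mem_ker, ad_apply]
  constructor
  · rintro ⟨w, hw, rfl⟩
    change ⁅φ y, φ w⁆ = 0
    rw [← φ.map_lie, hw, map_zero]
  · intro hz
    refine ⟨φ.symm z, φ.injective ?_, φ.apply_symm_apply z⟩
    change φ _ = φ _
    rw [φ.map_lie, φ.apply_symm_apply, hz, map_zero]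

theorem LieEquiv.finrank_ker_ad (φ : g ≃ₗ⁅ℂ⁆ g) (y : g) :
    finrank ℂ (LinearMap.ker (ad ℂ g (φ y))) = finrank ℂ (LinearMap.ker (ad ℂ g y)) := by
  rw [← φ.map_ker_ad]
  exact LinearEquiv.finrank_map_eq (φ : g ≃ₗ[ℂ] g) _

theorem IsRegularElement.map {y : g} (hy : IsRegularElement y) (φ : g ≃ₗ⁅ℂ⁆ g) :
    IsRegularElement (φ y) := fun z ↦ (φ.finrank_ker_ad y).trans_le (hy z)

theorem elementCentralizer_smul {c : ℂ} (hc : c ≠ 0) (y : g) :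
    elementCentralizer ℂ g (c • y) = elementCentralizer ℂ g y := by
  ext z
  simp [mem_elementCentralizer_iff, hc]

theorem IsRegularElement.smul {y : g} (hy : IsRegularElement y) {c : ℂ} (hc : c ≠ 0) :
    IsRegularElement (c • y) := fun z ↦ by
  rw [elementCentralizer_smul hc]
  exact hy z

theorem LieEquiv.Lifts.finrank_annihilatedBy {φ : g ≃ₗ⁅ℂ⁆ g} (hφ : φ.Lifts V) (y : g) :
    finrank ℂ (annihilatedBy (elementCentralizer ℂ g (φ y)) V) =
      finrank ℂ (annihilatedBy (elementCentralizer ℂ g y) V) := by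
  obtain ⟨T, hT⟩ := hφ
  have : (annihilatedBy (elementCentralizer ℂ g y) V).map T.toLinearMap =
      annihilatedBy (elementCentralizer ℂ g (φ y)) V := by
    ext v
    simp only [Submodule.mem_map, mem_annihilatedBy_elementCentralizer_iff, LinearEquiv.coe_coe]
    constructor
    · rintro ⟨w, hw, rfl⟩ z hz
      have h0 : ⁅y, φ.symm z⁆ = 0 := φ.injective (by
        change φ _ = φ _
        rw [φ.map_lie, φ.apply_symm_apply, hz, map_zero])
      have := hT (φ.symm z) w
      rw [hw _ h0, map_zero, φ.apply_symm_apply] at this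
      exact this.symm
    · intro hv
      refine ⟨T.symm v, fun z hz ↦ T.injective ?_, T.apply_symm_apply v⟩
      rw [hT, T.apply_symm_apply, map_zero]
      exact hv _ (by rw [← φ.map_lie, hz, map_zero])
  rw [← this]
  exact LinearEquiv.finrank_map_eq T _

end Transport

section Semicontinuity

theorem LinearMap.exists_comp_eq_of_ker_le {K E F G : Type*} [Field K] [AddCommGroup E]
    [Module K E] [AddCommGroup F] [Module K F] [AddCommGroup G] [Module K G] {f : E →ₗ[K] F}
    {h : E →ₗ[K] G} (hle : f.ker ≤ h.ker) : ∃ B : F →ₗ[K] G, B ∘ₗ f = h := by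
  obtain ⟨B, hB⟩ := LinearMap.exists_extend
    ((f.ker.liftQ h hle) ∘ₗ f.quotKerEquivRange.symm.toLinearMap)
  refine ⟨B, LinearMap.ext fun x ↦ ?_⟩
  have h1 : f.quotKerEquivRange.symm ⟨f x, LinearMap.mem_range_self f x⟩ = f.ker.mkQ x := by
    rw [LinearEquiv.symm_apply_eq]
    rfl
  have := LinearMap.congr_fun hB ⟨f x, LinearMap.mem_range_self f x⟩
  simp only [LinearMap.comp_apply, LinearEquiv.coe_coe, h1] at this
  exact this

variable {K E V : Type*} [Field K] [AddCommGroup E] [Module K E] [FiniteDimensional K E]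
  [AddCommGroup V] [Module K V] [FiniteDimensional K V]

theorem Module.End.finrank_ker_lcomp (f : End K E) :
    finrank K (LinearMap.ker (LinearMap.lcomp K V f)) =
      finrank K (LinearMap.ker f) * finrank K V := by
  have hr : LinearMap.range ((f.range.mkQ).lcomp K V) = LinearMap.ker (LinearMap.lcomp K V f) := by
    ext B
    simp only [LinearMap.mem_range, LinearMap.mem_ker]
    constructor
    · rintro ⟨C, rfl⟩
      ext v
      have : f.range.mkQ (f v) = 0 := by simp
      simp [LinearMap.lcomp_apply, -Submodule.mkQ_apply, this]
    · intro hB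
      have hle : f.range ≤ B.ker := by
        rintro _ ⟨v, rfl⟩
        exact LinearMap.congr_fun hB v
      exact ⟨f.range.liftQ B hle, f.range.liftQ_mkQ B hle⟩
  have hinj : Function.Injective ((f.range.mkQ).lcomp K V) := fun C D h ↦
    Submodule.linearMap_qext _ h
  rw [← hr, LinearMap.finrank_range_of_inj hinj, finrank_linearMap]
  congr 1
  have h1 := f.range.finrank_quotient_add_finrank
  have h2 := f.finrank_range_add_finrank_ker
  omega

/-- For `ρ : V → Hom(E, V)`, the space of pairs `(v, B)` with `ρ v = B ∘ f` fibres over the space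
of those `v` for which `ρ v` vanishes on `ker f`. -/
theorem LinearMap.finrank_ker_coprod_lcomp (ρ : V →ₗ[K] E →ₗ[K] V) (f : End K E)
    (W : Submodule K V) (hW : ∀ v, v ∈ W ↔ f.ker ≤ (ρ v).ker) :
    finrank K (LinearMap.ker (ρ.coprod (LinearMap.lcomp K V f))) =
      finrank K W + finrank K f.ker * finrank K V := by
  set S := LinearMap.ker (ρ.coprod (LinearMap.lcomp K V f))
  set p : S →ₗ[K] V := LinearMap.fst K V (E →ₗ[K] V) ∘ₗ S.subtype
  have hp : p.range = W := by
    ext v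
    rw [hW]
    constructor
    · rintro ⟨⟨⟨w, B⟩, hB⟩, rfl⟩ y hy
      have := LinearMap.congr_fun (show ρ w + B ∘ₗ f = 0 from hB) y
      rw [LinearMap.mem_ker] at hy ⊢
      rw [LinearMap.add_apply, LinearMap.comp_apply, hy, map_zero, add_zero] at this
      exact this
    · intro hv
      obtain ⟨B, hB⟩ := LinearMap.exists_comp_eq_of_ker_le hv
      refine ⟨⟨(v, -B), ?_⟩, rfl⟩
      change ρ v + (-B) ∘ₗ f = 0
      rw [LinearMap.neg_comp, hB, add_neg_cancel]
  have hk : finrank K p.ker = finrank K f.ker * finrank K V := by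
    rw [← Module.End.finrank_ker_lcomp (V := V) f]
    refine LinearEquiv.finrank_eq (LinearEquiv.ofBijective
      ((LinearMap.snd K V (E →ₗ[K] V) ∘ₗ S.subtype ∘ₗ p.ker.subtype).codRestrict _ ?_) ⟨?_, ?_⟩)
    · rintro ⟨⟨⟨w, B⟩, hB⟩, hw⟩
      have hw' : w = 0 := hw
      have hB' : ρ w + B ∘ₗ f = 0 := hB
      rw [hw', map_zero, zero_add] at hB'
      exact hB'
    · rintro ⟨⟨⟨w, B⟩, hB⟩, hw⟩ ⟨⟨⟨w', B'⟩, hB'⟩, hw'⟩ h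
      have h1 : w = 0 := hw
      have h2 : w' = 0 := hw'
      have h3 : B = B' := congrArg Subtype.val h
      subst h1 h2 h3
      rfl
    · rintro ⟨B, hB⟩
      have hB' : B ∘ₗ f = 0 := hB
      exact ⟨⟨⟨(0, B), show ρ 0 + B ∘ₗ f = 0 by rw [hB', map_zero, add_zero]⟩, rfl⟩, rfl⟩
  rw [← hp, ← hk]
  exact p.finrank_range_add_finrank_ker.symm

theorem finite_finrank_annihilatedBy_lt {g : Type*} [LieRing g] [LieAlgebra ℂ g]
    [FiniteDimensional ℂ g] {V : Type*} [AddCommGroup V] [Module ℂ V] [FiniteDimensional ℂ V]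
    [LieRingModule g V] [LieModule ℂ g V] {e : g} (he : IsRegularElement e) (s : g) :
    {t : ℂ | finrank ℂ (annihilatedBy (elementCentralizer ℂ g e) V) <
      finrank ℂ (annihilatedBy (elementCentralizer ℂ g (e + t • s)) V)}.Finite := by
  set ρ : V →ₗ[ℂ] g →ₗ[ℂ] V := (toEnd ℂ g V : g →ₗ[ℂ] End ℂ V).flip with hρ
  have key (y : g) := LinearMap.finrank_ker_coprod_lcomp ρ (ad ℂ g y)
    (annihilatedBy (elementCentralizer ℂ g y) V) (fun v ↦ Iff.rfl)
  refine (LinearMap.finite_finrank_ker_lt_add_smul (ρ.coprod (LinearMap.lcomp ℂ V (ad ℂ g e)))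
    ((0 : V →ₗ[ℂ] g →ₗ[ℂ] V).coprod (LinearMap.lcomp ℂ V (ad ℂ g s)))).subset fun t ht ↦ ?_
  have heq : ρ.coprod (LinearMap.lcomp ℂ V (ad ℂ g e)) +
      t • (0 : V →ₗ[ℂ] g →ₗ[ℂ] V).coprod (LinearMap.lcomp ℂ V (ad ℂ g s)) =
      ρ.coprod (LinearMap.lcomp ℂ V (ad ℂ g (e + t • s))) := by
    refine LinearMap.ext fun ⟨v, B⟩ ↦ LinearMap.ext fun y ↦ ?_
    simp [LinearMap.lcomp_apply, add_assoc]
  rw [Set.mem_ofPred_eq] at ht ⊢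
  rw [heq, key, key]
  have := Nat.mul_le_mul_right (finrank ℂ V) (he (e + t • s))
  exact add_lt_add_of_lt_of_le ht this

end Semicontinuity

section SqRegular

open Filter Topology

theorem Complex.induction_compl_finite {S : Set ℂ} (hS : S.Finite) (P : ℂ → ℂ → Prop)
    (hloc : ∀ x ∉ S, ∀ᶠ t in 𝓝 (0 : ℂ), x + t ∉ S → P x (x + t))
    (htrans : ∀ x y z, P x y → P y z → P x z) (hsymm : ∀ x y, P x y → P y x)
    {x y : ℂ} (hx : x ∉ S) (hy : y ∉ S) : P x y := by
  have hconn : IsPreconnected Sᶜ := (hS.countable.isConnected_compl_of_one_lt_rank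
    (by rw [Complex.rank_real_complex]; exact Nat.one_lt_ofNat)).isPreconnected
  refine hconn.induction₂ P (fun z hz ↦ ?_) (fun x y z _ _ _ ↦ htrans x y z)
    (fun x y _ _ ↦ hsymm x y) hx hy
  have ht : Tendsto (fun s : ℂ ↦ s - z) (𝓝 z) (𝓝 0) := by
    have : Continuous fun s : ℂ ↦ s - z := by fun_prop
    simpa using this.tendsto z
  filter_upwards [nhdsWithin_le_nhds (ht.eventually (hloc z hz)), self_mem_nhdsWithin] with s hs hs'
  rw [add_sub_cancel] at hs
  exact hs hs'

variable {g : Type*} [LieRing g] [LieAlgebra ℂ g]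

/-- An element `z` such that `(ad z) ^ 2` has kernel of the minimal possible dimension of a
centralizer; equivalently, a regular element such that `0` is a semisimple eigenvalue of `ad z`. -/
def IsSqRegularElement (z : g) : Prop :=
  ∀ y : g, finrank ℂ (LinearMap.ker ((ad ℂ g z) ^ 2)) ≤ finrank ℂ (LinearMap.ker (ad ℂ g y))

theorem Module.End.ker_le_ker_sq {E : Type*} [AddCommGroup E] [Module ℂ E] (f : End ℂ E) :
    LinearMap.ker f ≤ LinearMap.ker (f ^ 2) := fun v hv ↦ by
  rw [LinearMap.mem_ker] at hv ⊢
  rw [pow_two, Module.End.mul_apply, hv, map_zero]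

namespace IsSqRegularElement

theorem of_finrank_eq {z w : g} (hz : IsSqRegularElement z)
    (h : finrank ℂ (LinearMap.ker ((ad ℂ g w) ^ 2)) ≤ finrank ℂ (LinearMap.ker ((ad ℂ g z) ^ 2))) :
    IsSqRegularElement w := fun y ↦ h.trans (hz y)

theorem smul {z : g} (hz : IsSqRegularElement z) {c : ℂ} (hc : c ≠ 0) :
    IsSqRegularElement (c • z) := by
  refine hz.of_finrank_eq (le_of_eq ?_)
  rw [map_smul, smul_pow, LinearMap.ker_smul _ _ (pow_ne_zero 2 hc)]

theorem map {z : g} (hz : IsSqRegularElement z) (φ : g ≃ₗ⁅ℂ⁆ g) : IsSqRegularElement (φ z) := by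
  refine hz.of_finrank_eq (le_of_eq ?_)
  have : (LinearMap.ker ((ad ℂ g z) ^ 2)).map (φ : g ≃ₗ[ℂ] g).toLinearMap =
      LinearMap.ker ((ad ℂ g (φ z)) ^ 2) := by
    ext y
    simp only [Submodule.mem_map, LinearMap.mem_ker, pow_two, Module.End.mul_apply, ad_apply]
    constructor
    · rintro ⟨w, hw, rfl⟩
      change ⁅φ z, ⁅φ z, φ w⁆⁆ = 0
      rw [← φ.map_lie, ← φ.map_lie, hw, map_zero]
    · intro hy
      refine ⟨φ.symm y, φ.injective ?_, φ.apply_symm_apply y⟩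
      change φ _ = φ _
      rw [φ.map_lie, φ.map_lie, φ.apply_symm_apply, hy, map_zero]
  rw [← this]
  exact LinearEquiv.finrank_map_eq (φ : g ≃ₗ[ℂ] g) _

variable [FiniteDimensional ℂ g] {z : g} (hz : IsSqRegularElement z)
include hz

theorem ker_sq_eq : LinearMap.ker ((ad ℂ g z) ^ 2) = LinearMap.ker (ad ℂ g z) :=
  (Submodule.eq_of_le_of_finrank_le (Module.End.ker_le_ker_sq _) (hz z)).symm

theorem isRegularElement : IsRegularElement z := fun y ↦ by
  have := hz y
  rwa [hz.ker_sq_eq] at this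

theorem lie_eq_zero_of_lie_lie_eq_zero {y : g} (hy : ⁅z, ⁅z, y⁆⁆ = 0) : ⁅z, y⁆ = 0 := by
  have : y ∈ LinearMap.ker ((ad ℂ g z) ^ 2) := hy
  rwa [hz.ker_sq_eq] at this

theorem isCompl : IsCompl (LinearMap.ker (ad ℂ g z)) (LinearMap.range (ad ℂ g z)) := by
  rw [Submodule.isCompl_iff_disjoint _ _
    ((add_comm _ _).trans (ad ℂ g z).finrank_range_add_finrank_ker).ge]
  rw [Submodule.disjoint_def]
  rintro _ hx ⟨y, rfl⟩
  exact hz.lie_eq_zero_of_lie_lie_eq_zero hx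

theorem lie_eq_zero {x y : g} (hx : ⁅z, x⁆ = 0) (hy : ⁅z, y⁆ = 0) : ⁅x, y⁆ = 0 := by
  have hcomm : Commute (ad ℂ g z) (ad ℂ g x) := by
    refine LinearMap.ext fun v ↦ ?_
    change ⁅z, ⁅x, v⁆⁆ = ⁅x, ⁅z, v⁆⁆
    rw [leibniz_lie, hx, zero_lie, zero_add]
  have hfin := Module.End.finite_not_ker_sq_add_smul_le (ad ℂ g z) (ad ℂ g x) hcomm hz.isCompl
  obtain ⟨t, ht⟩ := (hfin.union (Set.finite_singleton (0 : ℂ))).exists_notMem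
  simp only [Set.mem_union, Set.mem_ofPred_eq, Set.mem_singleton_iff, not_or, not_not] at ht
  obtain ⟨ht, ht0⟩ := ht
  rw [← map_smul, ← map_add] at ht
  have heq := Submodule.eq_of_le_of_finrank_le ((Module.End.ker_le_ker_sq _).trans ht)
    (hz.isRegularElement (z + t • x))
  have hy' : y ∈ LinearMap.ker (ad ℂ g (z + t • x)) := heq ▸ hy
  rw [LinearMap.mem_ker, ad_apply, add_lie, hy, zero_add, smul_lie] at hy'
  exact (smul_eq_zero.mp hy').resolve_left ht0

/-- A regular element of the centralizer of `z` has the same centralizer as `z`. -/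
theorem ker_ad_eq_of_isRegularElement {w : g} (hw : ⁅z, w⁆ = 0) (hw' : IsRegularElement w) :
    LinearMap.ker (ad ℂ g w) = LinearMap.ker (ad ℂ g z) :=
  (Submodule.eq_of_le_of_finrank_le (fun _ hy ↦ hz.lie_eq_zero hw hy) (hw' z)).symm

variable (V : Type*) [AddCommGroup V] [Module ℂ V] [FiniteDimensional ℂ V] [LieRingModule g V]
  [LieModule ℂ g V]

theorem eventually_exists_lifts (u : g) : ∀ᶠ t in 𝓝 (0 : ℂ), IsSqRegularElement (z + t • u) →
    ∃ φ : g ≃ₗ⁅ℂ⁆ g, φ.Lifts V ∧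
      (LinearMap.ker (ad ℂ g z)).map (φ : g ≃ₗ[ℂ] g).toLinearMap =
        LinearMap.ker (ad ℂ g (z + t • u)) := by
  have := LieAlgebra.eventually_exists_expAd_apply_eq (A := ⊤) (W := LinearMap.ker (ad ℂ g z))
    (N := ⊤) (x := z) le_top (fun _ _ _ _ ↦ trivial) (fun _ _ _ _ ↦ trivial) (fun n _ ↦ ?_)
    (u := u) trivial
  · filter_upwards [this] with t ht hreg
    obtain ⟨y, -, w, hw, h⟩ := ht
    refine ⟨expAd y, lifts_expAd y, ?_⟩
    have hzw : IsRegularElement (z + w) := by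
      have h' := hreg.isRegularElement.map (expAd y).symm
      rwa [← h, (expAd y).symm_apply_apply] at h'
    have hker := hz.ker_ad_eq_of_isRegularElement (w := z + w)
      (by rw [lie_add, lie_self, zero_add]; exact hw) hzw
    rw [← h, ← hker, LieEquiv.map_ker_ad]
  · obtain ⟨a, ha, b, ⟨y, hy⟩, h⟩ := Submodule.mem_sup.mp
      (hz.isCompl.sup_eq_top.ge (Submodule.mem_top (x := n)))
    refine ⟨-y, trivial, a, ha, ?_⟩
    rw [← h, ← hy, neg_lie, lie_skew, ad_apply, add_comm]

theorem exists_lifts {z' : g} (hz' : IsSqRegularElement z') :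
    ∃ φ : g ≃ₗ⁅ℂ⁆ g, φ.Lifts V ∧
      (LinearMap.ker (ad ℂ g z)).map (φ : g ≃ₗ[ℂ] g).toLinearMap = LinearMap.ker (ad ℂ g z') := by
  set S : Set ℂ := {t | ¬ IsSqRegularElement (z + t • (z' - z))} with hS
  have hfin : S.Finite := by
    refine (Module.End.finite_finrank_ker_sq_lt_add_smul (ad ℂ g z) (ad ℂ g (z' - z))).subset
      fun t ht ↦ ?_
    rw [Set.mem_ofPred_eq]
    by_contra! hle
    rw [← map_smul, ← map_add] at hle
    exact ht (hz.of_finrank_eq hle)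
  have h0 : (0 : ℂ) ∉ S := by simpa [hS] using hz
  have h1 : (1 : ℂ) ∉ S := by simpa [hS] using hz'
  have := Complex.induction_compl_finite hfin (fun s t ↦ ∃ φ : g ≃ₗ⁅ℂ⁆ g, φ.Lifts V ∧
      (LinearMap.ker (ad ℂ g (z + s • (z' - z)))).map (φ : g ≃ₗ[ℂ] g).toLinearMap =
        LinearMap.ker (ad ℂ g (z + t • (z' - z)))) (fun s hs ↦ ?_) ?_ ?_ h0 h1
  · simpa using this
  · simp only [hS, Set.mem_ofPred_eq, not_not] at hs ⊢
    filter_upwards [hs.eventually_exists_lifts V (z' - z)] with t ht h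
    rw [add_smul, ← add_assoc] at h ⊢
    exact ht h
  · rintro a b c ⟨φ, hφ, h⟩ ⟨ψ, hψ, h'⟩
    refine ⟨φ.trans ψ, hφ.trans hψ, ?_⟩
    rw [← h', ← h, ← Submodule.map_comp]
    rfl
  · rintro a b ⟨φ, hφ, h⟩
    refine ⟨φ.symm, hφ.symm, ?_⟩
    rw [← h, ← Submodule.map_comp]
    convert Submodule.map_id _
    ext y
    exact φ.symm_apply_apply y

end IsSqRegularElement

end SqRegular

section Jordan

theorem Module.End.IsSemisimple.isCompl_ker_range {E : Type*} [AddCommGroup E] [Module ℂ E]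
    [FiniteDimensional ℂ E] {f : End ℂ E} (hf : f.IsSemisimple) :
    IsCompl (LinearMap.ker f) (LinearMap.range f) := by
  rw [Submodule.isCompl_iff_disjoint _ _ ((add_comm _ _).trans f.finrank_range_add_finrank_ker).ge,
    Submodule.disjoint_def]
  rintro _ hx ⟨y, rfl⟩
  have hy : y ∈ f.genEigenspace 0 (2 : ℕ) := by
    rw [Module.End.mem_genEigenspace_nat, zero_smul, sub_zero, pow_two]
    exact hx
  rw [Module.End.apply_eq_of_mem_of_comm_of_isFinitelySemisimple_of_isNil hy (Commute.refl f)
    hf.isFinitelySemisimple (by simp), zero_smul]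

variable {g : Type*} [LieRing g] [LieAlgebra ℂ g] [FiniteDimensional ℂ g] [IsKilling ℂ g]

theorem LieAlgebra.IsKilling.exists_semisimple_add_nilpotent (x : g) :
    ∃ s n : g, x = s + n ∧ ⁅s, n⁆ = 0 ∧ (ad ℂ g s).IsSemisimple ∧ IsNilpotent (ad ℂ g n) ∧
      ∀ y : g, ⁅x, y⁆ = 0 → ⁅s, y⁆ = 0 := by
  obtain ⟨N, -, S, hS₀, hN, hS, hSN⟩ := (ad ℂ g x).exists_isNilpotent_isSemisimple
  replace hS₀ : Commute (ad ℂ g x) S := Algebra.commute_of_mem_adjoin_self hS₀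
  have hN' : IsNilpotent (ad ℂ g x - S) := by rwa [hSN, add_sub_cancel_right]
  have aux {μ : ℂ} {y : g} (hy : y ∈ (ad ℂ g x).maxGenEigenspace μ) : S y = μ • y :=
    Module.End.apply_eq_of_mem_of_comm_of_isFinitelySemisimple_of_isNil hy hS₀
      hS.isFinitelySemisimple hN'
  have h_der (y z : g) : S ⁅y, z⁆ = ⁅S y, z⁆ + ⁅y, S z⁆ := by
    have hy : y ∈ ⨆ μ, (ad ℂ g x).maxGenEigenspace μ := by
      rw [Module.End.iSup_maxGenEigenspace_eq_top]; trivial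
    have hz : z ∈ ⨆ μ, (ad ℂ g x).maxGenEigenspace μ := by
      rw [Module.End.iSup_maxGenEigenspace_eq_top]; trivial
    induction hy using Submodule.iSup_induction' with
    | mem μ y hy =>
      induction hz using Submodule.iSup_induction' with
      | mem ν z hz =>
        have hyz : ⁅y, z⁆ ∈ (ad ℂ g x).maxGenEigenspace (μ + ν) :=
          lie_mem_maxGenEigenspace_toEnd hy hz
        rw [aux hy, aux hz, aux hyz, smul_lie, lie_smul, ← add_smul]
      | zero => simp
      | add _ _ _ _ h h' => simp only [lie_add, map_add, h, h']; abel
    | zero => simp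
    | add _ _ _ _ h h' => simp only [add_lie, map_add, h, h']; abel
  let S' : LieDerivation ℂ g g := ⟨S, fun y z ↦ by
    rw [h_der, ← lie_skew z (S y), sub_neg_eq_add, add_comm]⟩
  obtain ⟨s, hs⟩ := LieDerivation.IsKilling.exists_eq_ad S'
  have hs' : ad ℂ g s = S := by rw [← LieDerivation.coe_ad_apply_eq_ad_apply s, hs]
  have hsapp (y : g) : ⁅s, y⁆ = S y := LinearMap.congr_fun hs' y
  have hker (y : g) (hy : ⁅x, y⁆ = 0) : ⁅s, y⁆ = 0 := by
    have : y ∈ (ad ℂ g x).maxGenEigenspace 0 := by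
      rw [Module.End.mem_maxGenEigenspace]
      exact ⟨1, by simpa using hy⟩
    rw [hsapp, aux this, zero_smul]
  refine ⟨s, x - s, by abel, ?_, hs' ▸ hS, ?_, hker⟩
  · rw [lie_sub, lie_self, sub_zero]
    exact hker x (lie_self x)
  · rw [map_sub, hs']
    exact hN'

theorem LieAlgebra.IsKilling.mem_range_ad_of_killingForm_eq_zero {x n : g}
    (h : ∀ z, ⁅x, z⁆ = 0 → killingForm ℂ g z n = 0) : n ∈ LinearMap.range (ad ℂ g x) := by
  by_contra hn
  obtain ⟨ℓ, hℓ, hle⟩ := Submodule.exists_le_ker_of_notMem hn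
  have hinj : Function.Injective (killingForm ℂ g) :=
    LinearMap.ker_eq_bot.mp (ker_killingForm_eq_bot ℂ g)
  obtain ⟨z, rfl⟩ := (LinearMap.injective_iff_surjective_of_finrank_eq_finrank
    (Subspace.dual_finrank_eq (K := ℂ) (V := g)).symm).mp hinj ℓ
  refine hℓ (h z ?_)
  rw [← lie_skew, neg_eq_zero]
  refine hinj ?_
  ext y
  rw [map_zero, LinearMap.zero_apply, killingForm, traceForm_apply_lie_apply]
  exact hle (LinearMap.mem_range_self (ad ℂ g x) y)

theorem LieAlgebra.IsKilling.exists_lie_eq_self {s n : g} (hsn : ⁅s, n⁆ = 0)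
    (hs : (ad ℂ g s).IsSemisimple) (hn : IsNilpotent (ad ℂ g n))
    (hker : ∀ y : g, ⁅s + n, y⁆ = 0 → ⁅s, y⁆ = 0) : ∃ h : g, ⁅h, s⁆ = 0 ∧ ⁅h, n⁆ = n := by
  obtain ⟨h₀, hh₀⟩ := mem_range_ad_of_killingForm_eq_zero (x := s + n) (n := n) fun z hz ↦ by
    have hnz : ⁅n, z⁆ = 0 := by
      have := hker z hz
      rwa [add_lie, this, zero_add] at hz
    have hcomm : Commute (ad ℂ g z) (ad ℂ g n) := by
      refine LinearMap.ext fun v ↦ ?_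
      change ⁅z, ⁅n, v⁆⁆ = ⁅n, ⁅z, v⁆⁆
      rw [leibniz_lie n, hnz, zero_lie, zero_add]
    rw [killingForm_apply_apply]
    exact (LinearMap.isNilpotent_trace_of_isNilpotent (hcomm.isNilpotent_mul_left hn)).eq_zero
  have hcompl := hs.isCompl_ker_range
  obtain ⟨a, ha, b, ⟨c, rfl⟩, rfl⟩ := Submodule.mem_sup.mp
    (hcompl.sup_eq_top.ge (Submodule.mem_top (x := h₀)))
  rw [LinearMap.mem_ker] at ha
  simp only [ad_apply] at ha hh₀
  refine ⟨-a, by rw [neg_lie, ← lie_skew, ha, neg_zero, neg_zero], ?_⟩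
  have hna : ⁅s, ⁅n, a⁆⁆ = 0 := by rw [leibniz_lie, hsn, ha, zero_lie, lie_zero, zero_add]
  have hnc : ⁅n, ⁅s, c⁆⁆ = ⁅s, ⁅n, c⁆⁆ := by rw [leibniz_lie s, hsn, zero_lie, zero_add]
  have hmem : n - ⁅n, a⁆ ∈ LinearMap.range (ad ℂ g s) := by
    refine ⟨⁅s, c⁆ + ⁅n, c⁆, ?_⟩
    rw [eq_sub_iff_add_eq]
    refine Eq.trans ?_ hh₀
    simp only [ad_apply, lie_add, add_lie, ha, hnc]
    abel
  have hmem' : n - ⁅n, a⁆ ∈ LinearMap.ker (ad ℂ g s) := by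
    rw [LinearMap.mem_ker, ad_apply, lie_sub, hsn, hna, sub_zero]
  have := Submodule.disjoint_def.mp hcompl.disjoint _ hmem' hmem
  rw [neg_lie, lie_skew]
  exact (sub_eq_zero.mp this).symm

theorem LieAlgebra.IsKilling.exists_isSqRegularElement {s n : g} (hsn : ⁅s, n⁆ = 0)
    (hs : (ad ℂ g s).IsSemisimple) (hn : IsNilpotent (ad ℂ g n))
    (hker : ∀ y : g, ⁅s + n, y⁆ = 0 → ⁅s, y⁆ = 0) (hreg : IsRegularElement (s + n)) :
    ∃ z : g, IsSqRegularElement z ∧ ⁅z, s⁆ = 0 ∧ ⁅z, n⁆ = n := by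
  obtain ⟨h, hhs, hhn⟩ := exists_lie_eq_self hsn hs hn hker
  have hcomm : Commute (ad ℂ g s) (ad ℂ g h) := by
    refine LinearMap.ext fun v ↦ ?_
    change ⁅s, ⁅h, v⁆⁆ = ⁅h, ⁅s, v⁆⁆
    rw [leibniz_lie h, hhs, zero_lie, zero_add]
  have hfin := Module.End.finite_not_ker_sq_add_smul_le (ad ℂ g s) (ad ℂ g h) hcomm
    hs.isCompl_ker_range
  obtain ⟨t, ht⟩ := (hfin.union (Set.finite_singleton (0 : ℂ))).exists_notMem
  simp only [Set.mem_union, Set.mem_ofPred_eq, Set.mem_singleton_iff, not_or, not_not] at ht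
  obtain ⟨ht, ht0⟩ := ht
  rw [← map_smul, ← map_add] at ht
  have hz : IsSqRegularElement (s + t • h) := by
    intro y
    have h1 : LinearMap.ker ((ad ℂ g (s + t • h)) ^ 2) ≤
        LinearMap.ker ((ad ℂ g h) ^ 2) ⊓ LinearMap.ker (ad ℂ g s) := by
      intro v hv
      have hv' : ⁅s, v⁆ = 0 := ht hv
      refine ⟨?_, hv'⟩
      have hsh : ⁅s, ⁅h, v⁆⁆ = 0 := by
        have := LinearMap.congr_fun hcomm.eq v
        change ⁅s, ⁅h, v⁆⁆ = ⁅h, ⁅s, v⁆⁆ at this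
        rw [this, hv', lie_zero]
      have hv2 : ⁅s + t • h, ⁅s + t • h, v⁆⁆ = 0 := hv
      simp only [add_lie, smul_lie, lie_smul, hv', hsh, zero_add, smul_smul] at hv2
      exact (smul_eq_zero.mp hv2).resolve_left (mul_ne_zero ht0 ht0)
    have h2 := Module.End.finrank_ker_sq_inf_le (D := ad ℂ g h) (N := ad ℂ g n)
      (by
        refine LinearMap.ext fun v ↦ ?_
        change ⁅h, ⁅n, v⁆⁆ = ⁅n, ⁅h, v⁆⁆ + ⁅n, v⁆
        rw [leibniz_lie, hhn, add_comm])
      (LinearMap.ker (ad ℂ g s)) (fun v hv ↦ by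
        rw [LinearMap.mem_ker, ad_apply] at hv
        rw [LinearMap.mem_ker, ad_apply, ad_apply, leibniz_lie, hsn, hv, zero_lie, lie_zero,
          zero_add])
    have h3 : LinearMap.ker (ad ℂ g n) ⊓ LinearMap.ker (ad ℂ g s) ≤
        LinearMap.ker (ad ℂ g (s + n)) := by
      rintro v ⟨hv1, hv2⟩
      rw [LinearMap.mem_ker, map_add, LinearMap.add_apply, LinearMap.mem_ker.mp hv1,
        LinearMap.mem_ker.mp hv2, add_zero]
    exact (Submodule.finrank_mono h1).trans (h2.trans ((Submodule.finrank_mono h3).trans (hreg y)))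
  refine ⟨t⁻¹ • (s + t • h), hz.smul (inv_ne_zero ht0), ?_, ?_⟩
  · rw [smul_lie, add_lie, lie_self, smul_lie, hhs, smul_zero, add_zero, smul_zero]
  · rw [smul_lie, add_lie, hsn, smul_lie, hhn, zero_add, smul_smul, inv_mul_cancel₀ ht0, one_smul]

end Jordan

section PosPart

open Filter Topology

variable {g : Type*} [LieRing g] [LieAlgebra ℂ g]

/-- The sum of the generalized eigenspaces of `ad ζ` whose eigenvalue has positive real part. -/
def LieAlgebra.posPart (ζ : g) : Submodule ℂ g :=
  ⨆ μ : {μ : ℂ // 0 < μ.re}, (ad ℂ g ζ).maxGenEigenspace μ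

theorem LieAlgebra.mem_posPart_of_lie_eq_smul {ζ v : g} {μ : ℂ} (hμ : 0 < μ.re)
    (h : ⁅ζ, v⁆ = μ • v) : v ∈ posPart ζ := by
  refine (le_iSup (fun μ : {μ : ℂ // 0 < μ.re} ↦ (ad ℂ g ζ).maxGenEigenspace μ) ⟨μ, hμ⟩) ?_
  rw [Module.End.mem_maxGenEigenspace]
  exact ⟨1, by simp [h]⟩

theorem LieAlgebra.mem_maxGenEigenspace_zero {ζ u : g} (hu : ⁅ζ, u⁆ = 0) :
    u ∈ (ad ℂ g ζ).maxGenEigenspace 0 := by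
  rw [Module.End.mem_maxGenEigenspace]
  exact ⟨1, by simpa using hu⟩

theorem LieAlgebra.lie_mem_posPart_of_mem_maxGenEigenspace {ζ u v : g} {μ : ℂ} (hμ : 0 ≤ μ.re)
    (hu : u ∈ (ad ℂ g ζ).maxGenEigenspace μ) (hv : v ∈ posPart ζ) : ⁅u, v⁆ ∈ posPart ζ := by
  induction hv using Submodule.iSup_induction' with
  | mem ν v hv =>
    have huv : ⁅u, v⁆ ∈ (ad ℂ g ζ).maxGenEigenspace (μ + ν) := lie_mem_maxGenEigenspace_toEnd hu hv
    exact (le_iSup (fun μ : {μ : ℂ // 0 < μ.re} ↦ (ad ℂ g ζ).maxGenEigenspace μ)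
      ⟨μ + ν, by rw [Complex.add_re]; exact add_pos_of_nonneg_of_pos hμ ν.2⟩) huv
  | zero => rw [lie_zero]; exact Submodule.zero_mem _
  | add v w _ _ hv hw => rw [lie_add]; exact Submodule.add_mem _ hv hw

theorem LieAlgebra.lie_mem_posPart_of_lie_eq_zero {ζ u v : g} (hu : ⁅ζ, u⁆ = 0)
    (hv : v ∈ posPart ζ) : ⁅u, v⁆ ∈ posPart ζ :=
  lie_mem_posPart_of_mem_maxGenEigenspace le_rfl (mem_maxGenEigenspace_zero hu) hv

theorem LieAlgebra.lie_mem_posPart {ζ u v : g} (hu : u ∈ posPart ζ) (hv : v ∈ posPart ζ) :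
    ⁅u, v⁆ ∈ posPart ζ := by
  induction hu using Submodule.iSup_induction' with
  | mem μ u hu => exact lie_mem_posPart_of_mem_maxGenEigenspace μ.2.le hu hv
  | zero => rw [zero_lie]; exact Submodule.zero_mem _
  | add u w _ _ hu hw => rw [add_lie]; exact Submodule.add_mem _ hu hw

theorem LieAlgebra.disjoint_ker_ad_posPart (ζ : g) :
    Disjoint (LinearMap.ker (ad ℂ g ζ)) (posPart ζ) := by
  refine ((ad ℂ g ζ).independent_maxGenEigenspace 0).mono (fun v hv ↦ mem_maxGenEigenspace_zero hv)
    (iSup_le fun μ ↦ le_iSup₂_of_le (μ : ℂ) ?_ le_rfl)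
  rintro h
  have := μ.2
  simp [h] at this

variable [FiniteDimensional ℂ g]

theorem IsRegularElement.finite_not_add_smul {y : g} (hy : IsRegularElement y) (d : g) :
    {t : ℂ | ¬ IsRegularElement (y + t • d)}.Finite := by
  refine (LinearMap.finite_finrank_ker_lt_add_smul (ad ℂ g y) (ad ℂ g d)).subset fun t ht ↦ ?_
  rw [Set.mem_ofPred_eq]
  by_contra! hle
  rw [← map_smul, ← map_add] at hle
  exact ht fun z ↦ hle.trans (hy z)

variable {ζ : g} (hζ : IsSqRegularElement ζ)
include hζ

/-- If `s` centralizes `ζ` and `s + n` is regular with `n` in the positive part, then bracketing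
with `s + n` maps the Borel subalgebra attached to `ζ` onto the positive part. -/
theorem IsSqRegularElement.exists_lie_eq_of_mem_posPart {s n : g} (hs : ⁅ζ, s⁆ = 0)
    (hn : n ∈ posPart ζ) (hreg : IsRegularElement (s + n)) :
    (∀ y ∈ LinearMap.ker (ad ℂ g ζ) ⊔ posPart ζ, ⁅y, s + n⁆ ∈ posPart ζ) ∧
      ∀ m ∈ posPart ζ, ∃ y ∈ LinearMap.ker (ad ℂ g ζ) ⊔ posPart ζ, ⁅y, s + n⁆ = m := by
  set b := LinearMap.ker (ad ℂ g ζ) ⊔ posPart ζ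
  have hmem : ∀ y ∈ b, ⁅y, s + n⁆ ∈ posPart ζ := by
    intro y hy
    obtain ⟨a, ha, c, hc, rfl⟩ := Submodule.mem_sup.mp hy
    rw [add_lie, lie_add, lie_add, hζ.lie_eq_zero ha hs, zero_add, ← lie_skew c s]
    exact Submodule.add_mem _ (lie_mem_posPart_of_lie_eq_zero ha hn)
      (Submodule.add_mem _ (Submodule.neg_mem _ (lie_mem_posPart_of_lie_eq_zero hs hc))
        (lie_mem_posPart hc hn))
  refine ⟨hmem, ?_⟩
  have hle : b.map (ad ℂ g (s + n)) ≤ posPart ζ := by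
    rintro _ ⟨y, hy, rfl⟩
    rw [ad_apply, ← lie_skew]
    exact Submodule.neg_mem _ (hmem y hy)
  have hb : finrank ℂ b = finrank ℂ (LinearMap.ker (ad ℂ g ζ)) + finrank ℂ (posPart ζ) := by
    have := Submodule.finrank_sup_add_finrank_inf_eq (LinearMap.ker (ad ℂ g ζ)) (posPart ζ)
    rwa [(disjoint_ker_ad_posPart ζ).eq_bot, finrank_bot, add_zero] at this
  have hdim : finrank ℂ (posPart ζ) ≤ finrank ℂ (b.map (ad ℂ g (s + n))) := by
    have h1 := ((ad ℂ g (s + n)).domRestrict b).finrank_range_add_finrank_ker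
    rw [LinearMap.range_domRestrict] at h1
    have h2 : finrank ℂ (LinearMap.ker ((ad ℂ g (s + n)).domRestrict b)) ≤
        finrank ℂ (LinearMap.ker (ad ℂ g (s + n))) := by
      rw [LinearMap.ker_domRestrict, ← Submodule.finrank_map_subtype_eq]
      exact Submodule.finrank_mono (Submodule.map_comap_le _ _)
    have h3 : finrank ℂ (LinearMap.ker (ad ℂ g (s + n))) ≤ finrank ℂ (LinearMap.ker (ad ℂ g ζ)) :=
      hreg ζ
    omega
  have heq := Submodule.eq_of_le_of_finrank_le hle hdim
  intro m hm
  rw [← heq] at hm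
  obtain ⟨y, hy, rfl⟩ := hm
  exact ⟨-y, b.neg_mem hy, by rw [neg_lie, lie_skew, ad_apply]⟩

variable (V : Type*) [AddCommGroup V] [Module ℂ V] [FiniteDimensional ℂ V] [LieRingModule g V]
  [LieModule ℂ g V]

theorem IsSqRegularElement.exists_lifts_apply_eq {s n m : g} (hs : ⁅ζ, s⁆ = 0)
    (hn : n ∈ posPart ζ) (hm : m ∈ posPart ζ) (hsn : IsRegularElement (s + n))
    (hsm : IsRegularElement (s + m)) : ∃ φ : g ≃ₗ⁅ℂ⁆ g, φ.Lifts V ∧ φ (s + n) = s + m := by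
  have hfin := hsn.finite_not_add_smul (m - n)
  have hmn := Submodule.sub_mem _ hm hn
  have := Complex.induction_compl_finite hfin (fun a b ↦ ∃ φ : g ≃ₗ⁅ℂ⁆ g, φ.Lifts V ∧
      φ (s + n + a • (m - n)) = s + n + b • (m - n)) (x := 0) (y := 1) (fun a ha ↦ ?_) ?_ ?_
      (by simpa using hsn) (by simpa using hsm)
  · simpa using this
  · have hna : n + a • (m - n) ∈ posPart ζ := Submodule.add_mem _ hn (Submodule.smul_mem _ _ hmn)
    simp only [Set.mem_ofPred_eq, not_not, add_assoc s n] at ha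
    obtain ⟨h1, h2⟩ := hζ.exists_lie_eq_of_mem_posPart hs hna ha
    have hloc := LieAlgebra.eventually_exists_expAd_apply_eq
      (A := LinearMap.ker (ad ℂ g ζ) ⊔ posPart ζ)
      (W := ⊥) (N := posPart ζ) (x := s + (n + a • (m - n))) bot_le
      (fun y hy w hw ↦ by
        rw [Submodule.mem_bot] at hw
        rw [hw, add_zero]
        exact h1 y hy)
      (fun y hy v hv ↦ by
        obtain ⟨c, hc, d, hd, rfl⟩ := Submodule.mem_sup.mp hy
        rw [add_lie]
        exact Submodule.add_mem _ (lie_mem_posPart_of_lie_eq_zero hc hv) (lie_mem_posPart hd hv))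
      (fun v hv ↦ by
        obtain ⟨y, hy, h⟩ := h2 v hv
        exact ⟨y, hy, 0, Submodule.zero_mem _, by rw [h, add_zero]⟩) hmn
    filter_upwards [hloc] with t ht _
    obtain ⟨y, -, w, hw, h⟩ := ht
    rw [Submodule.mem_bot] at hw
    rw [hw, add_zero] at h
    refine ⟨expAd y, lifts_expAd y, ?_⟩
    rw [add_assoc s n, h, add_smul]
    abel
  · rintro a b c ⟨φ, hφ, h⟩ ⟨ψ, hψ, h'⟩
    exact ⟨φ.trans ψ, hφ.trans hψ, by rw [LieEquiv.trans_apply, h, h']⟩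
  · rintro a b ⟨φ, hφ, h⟩
    exact ⟨φ.symm, hφ.symm, by rw [← h, φ.symm_apply_apply]⟩

theorem IsSqRegularElement.finrank_annihilatedBy_le {e s n : g} {c : ℂ} (hc : 0 < c.re)
    (hζe : ⁅ζ, e⁆ = c • e) (he : IsRegularElement e) (hs : ⁅ζ, s⁆ = 0)
    (hn : n ∈ posPart ζ) (hsn : IsRegularElement (s + n)) :
    finrank ℂ (annihilatedBy (elementCentralizer ℂ g (s + n)) V) ≤
      finrank ℂ (annihilatedBy (elementCentralizer ℂ g e) V) := by
  obtain ⟨t, ht⟩ := ((finite_finrank_annihilatedBy_lt (V := V) he s).union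
    ((he.finite_not_add_smul s).union (Set.finite_singleton (0 : ℂ)))).exists_notMem
  simp only [Set.mem_union, Set.mem_ofPred_eq, Set.mem_singleton_iff, not_or, not_not,
    not_lt] at ht
  obtain ⟨hle, hreg, ht0⟩ := ht
  have heq : e + t • s = t • (s + t⁻¹ • e) := by
    rw [smul_add, smul_smul, mul_inv_cancel₀ ht0, one_smul, add_comm]
  have hreg' : IsRegularElement (s + t⁻¹ • e) := by
    have := hreg.smul (inv_ne_zero ht0)
    rwa [heq, smul_smul, inv_mul_cancel₀ ht0, one_smul] at this
  obtain ⟨φ, hφ, h⟩ := hζ.exists_lifts_apply_eq V hs hn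
    (Submodule.smul_mem _ t⁻¹ (mem_posPart_of_lie_eq_smul hc hζe)) hsn hreg'
  rw [heq, elementCentralizer_smul ht0, ← h, hφ.finrank_annihilatedBy] at hle
  exact hle

end PosPart

section Weyl

variable {g : Type*} [LieRing g] [LieAlgebra ℂ g] [FiniteDimensional ℂ g]

theorem IsSqRegularElement.isCartanSubalgebra {h : g} (hh : IsSqRegularElement h) :
    (elementCentralizer ℂ g h).IsCartanSubalgebra where
  nilpotent := by
    have : IsLieAbelian (elementCentralizer ℂ g h) :=
      ⟨fun x y ↦ Subtype.ext (hh.lie_eq_zero (mem_elementCentralizer_iff.mp x.2)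
        (mem_elementCentralizer_iff.mp y.2))⟩
    infer_instance
  self_normalizing := by
    refine le_antisymm (fun y hy ↦ ?_) (LieSubalgebra.le_normalizer _)
    refine mem_elementCentralizer_iff.mpr (hh.lie_eq_zero_of_lie_lie_eq_zero ?_)
    exact mem_elementCentralizer_iff.mp
      ((LieSubalgebra.mem_normalizer_iff' _ _).mp hy h
        (mem_elementCentralizer_iff.mpr (lie_self h)))

namespace LieAlgebra.IsKilling

variable [IsKilling ℂ g] {H : LieSubalgebra ℂ g} [H.IsCartanSubalgebra]

theorem coe_lie_eq_smul_of_mem_rootSpace {α : H → ℂ} {v : g} (hv : v ∈ rootSpace H α) (w : H) :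
    ⁅(w : g), v⁆ = α w • v := lie_eq_smul_of_mem_rootSpace hv w

variable (V : Type*) [AddCommGroup V] [Module ℂ V] [FiniteDimensional ℂ V] [LieRingModule g V]
  [LieModule ℂ g V]

/-- Reflections in roots are induced by automorphisms that lift to every representation. -/
theorem exists_lifts_apply_eq_sub_smul_coroot {α : Weight ℂ H g} (hα : α.IsNonZero) :
    ∃ φ : g ≃ₗ⁅ℂ⁆ g, φ.Lifts V ∧ ∀ w : H, φ w = (w - α w • coroot α : H) := by
  obtain ⟨h, e, f, ht, he, hf⟩ := exists_isSl2Triple_of_weight_isNonZero hα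
  have hh := ht.h_eq_coroot hα he hf
  set x : g := (Complex.I * Real.pi / 2) • (e + f) with hx
  have heh : ⁅e, h⁆ = -(2 : ℂ) • e := by rw [← lie_skew, ht.lie_h_e_smul ℂ, neg_smul]
  have hfh : ⁅f, h⁆ = (2 : ℂ) • f := by rw [← lie_skew, ht.lie_lie_smul_f ℂ, neg_neg]
  have hfe : ⁅f, e⁆ = -h := by rw [← lie_skew, ht.lie_e_f]
  have h1 : (expAd x) (h + (e - f)) = -(h + (e - f)) := by
    rw [expAd_apply, Module.End.exp_apply_of_apply_eq_smul (c := -(Real.pi * Complex.I)),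
      Complex.exp_neg, Complex.exp_pi_mul_I]
    · module
    · rw [ad_apply, hx]
      simp only [smul_lie, add_lie, lie_add, lie_sub, heh, hfh, hfe, ht.lie_e_f, lie_self]
      module
  have h2 : (expAd x) (h - (e - f)) = -(h - (e - f)) := by
    rw [expAd_apply, Module.End.exp_apply_of_apply_eq_smul (c := Real.pi * Complex.I),
      Complex.exp_pi_mul_I]
    · module
    · rw [ad_apply, hx]
      simp only [smul_lie, add_lie, lie_sub, heh, hfh, hfe, ht.lie_e_f, lie_self]
      module
  have h3 : (expAd x) h = -h := by
    have : h = (1 / 2 : ℂ) • (h + (e - f)) + (1 / 2 : ℂ) • (h - (e - f)) := by module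
    conv_lhs => rw [this]
    rw [map_add, map_smul, map_smul, h1, h2]
    module
  refine ⟨expAd x, lifts_expAd x, fun w ↦ ?_⟩
  have hfix : (expAd x) (w - (α w / 2) • h) = w - (α w / 2) • h := by
    rw [expAd_apply]
    refine Module.End.exp_apply_of_apply_eq_zero ?_
    have hwe : ⁅e, (w : g)⁆ = -α w • e := by
      rw [← lie_skew, coe_lie_eq_smul_of_mem_rootSpace he, neg_smul]
    have hwf : ⁅f, (w : g)⁆ = α w • f := by
      rw [← lie_skew, coe_lie_eq_smul_of_mem_rootSpace hf, Pi.neg_apply, neg_smul, neg_neg]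
    rw [ad_apply, hx]
    simp only [smul_lie, add_lie, lie_sub, lie_smul, heh, hfh, hwe, hwf]
    module
  have hw : (w : g) = (w - (α w / 2) • h) + (α w / 2) • h := by module
  conv_lhs => rw [hw]
  rw [map_add, hfix, map_smul, h3]
  push_cast
  rw [← hh]
  module

theorem exists_traceForm_coroot_eq {α : Weight ℂ H g} (hα : α.IsNonZero) :
    ∃ r : ℝ, 0 < r ∧ ∀ w : H, traceForm ℂ H g w (coroot α) = r * α w := by
  set c : ℂ := 2 • (α <| (cartanEquivDual H).symm α)⁻¹ with hc
  have hform (w : H) : traceForm ℂ H g (coroot α) w = c * α w := by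
    rw [traceForm_coroot, hc, smul_eq_mul, smul_mul_assoc]
  set S : ℝ := ∑ β ∈ H.root, ((chainBotCoeff α β - chainTopCoeff α β : ℤ) : ℝ) ^ 2 with hS
  have hsum : traceForm ℂ H g (coroot α) (coroot α) = S := by
    rw [← restrict_killingForm, restrict_killingForm_eq_sum, hS]
    simp only [LinearMap.sum_apply, LinearMap.smulRight_apply, Weight.toLinear_apply,
      LinearMap.smul_apply, smul_eq_mul, apply_coroot_eq_cast]
    push_cast
    exact Finset.sum_congr rfl fun β _ ↦ by ring
  have hpos : 0 < S := by
    refine Finset.sum_pos' (fun β _ ↦ sq_nonneg _) ⟨α, by simpa [LieSubalgebra.root] using hα, ?_⟩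
    have h2 : ((chainBotCoeff α α - chainTopCoeff α α : ℤ) : ℂ) = (2 : ℤ) := by
      rw [← apply_coroot_eq_cast, root_apply_coroot hα]; norm_num
    rw [Int.cast_injective h2]
    norm_num
  have h2 := hform (coroot α)
  rw [hsum, root_apply_coroot hα] at h2
  refine ⟨S / 2, by positivity, fun w ↦ ?_⟩
  rw [traceForm_comm, hform]
  push_cast
  rw [h2]
  ring

theorem finite_setOf_forall_weight_mem {F : Set ℂ} (hF : F.Finite) :
    {w : H | ∀ β : Weight ℂ H g, β w ∈ F}.Finite := by
  refine Set.Finite.of_finite_image (f := fun w (β : Weight ℂ H g) ↦ β w)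
    ((Set.Finite.pi' fun _ : Weight ℂ H g ↦ hF).subset ?_) ?_
  · rintro _ ⟨w, hw, rfl⟩
    exact hw
  · intro w _ w' _ h
    have : w - w' ∈ ⨅ α : Weight ℂ H g, α.ker := by
      simp only [Submodule.mem_iInf, LinearMap.mem_ker, map_sub, Weight.toLinear_apply]
      exact fun β ↦ sub_eq_zero.mpr (congrFun h β)
    rw [iInf_ker_weight_eq_bot] at this
    exact sub_eq_zero.mp this

theorem hasEigenvalue_weight (β : Weight ℂ H g) (w : H) : (ad ℂ g w).HasEigenvalue (β w) := by
  obtain ⟨v, hv, hv0⟩ := β.exists_ne_zero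
  exact Module.End.hasEigenvalue_of_hasEigenvector
    ⟨Module.End.mem_eigenspace_iff.mpr (coe_lie_eq_smul_of_mem_rootSpace hv w), hv0⟩

theorem weight_apply_ne_zero {h : g} (hh : LinearMap.ker (ad ℂ g h) ≤ H.toSubmodule)
    (hmem : h ∈ H) {β : Weight ℂ H g} (hβ : β.IsNonZero) : β ⟨h, hmem⟩ ≠ 0 := by
  intro h0
  obtain ⟨v, hv, hv0⟩ := β.exists_ne_zero
  have hvH : v ∈ H := hh <| by
    have := coe_lie_eq_smul_of_mem_rootSpace hv ⟨h, hmem⟩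
    rwa [h0, zero_smul] at this
  refine hβ (funext fun w ↦ ?_)
  have h1 : ⁅w, (⟨v, hvH⟩ : H)⁆ = 0 := trivial_lie_zero _ _ _ _
  have h2 := coe_lie_eq_smul_of_mem_rootSpace hv w
  rw [show ⁅(w : g), v⁆ = 0 from congrArg Subtype.val h1] at h2
  exact (smul_eq_zero.mp h2.symm).resolve_right hv0

theorem mem_posPart_of_forall_weight {w ζ : H} {n : g} (hn : ⁅(w : g), n⁆ = n)
    (hpos : ∀ β : Weight ℂ H g, β w = 1 → 0 < (β ζ).re) : n ∈ posPart (ζ : g) := by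
  set Q : Submodule ℂ g := ⨆ μ : ℂ, ⨆ _ : μ ≠ 1, (ad ℂ g w).eigenspace μ with hQ
  have htop : posPart (ζ : g) ⊓ (ad ℂ g w).eigenspace 1 ⊔ Q = ⊤ := by
    have := congrArg LieSubmodule.toSubmodule (iSup_genWeightSpace_eq_top' ℂ H g)
    rw [LieSubmodule.iSup_toSubmodule, LieSubmodule.top_toSubmodule] at this
    rw [eq_top_iff, ← this, iSup_le_iff]
    intro β v hv
    have hw : v ∈ (ad ℂ g w).eigenspace (β w) :=
      Module.End.mem_eigenspace_iff.mpr (coe_lie_eq_smul_of_mem_rootSpace hv w)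
    by_cases h1 : β w = 1
    · refine Submodule.mem_sup_left ⟨?_, h1 ▸ hw⟩
      exact mem_posPart_of_lie_eq_smul (hpos β h1) (coe_lie_eq_smul_of_mem_rootSpace hv ζ)
    · exact Submodule.mem_sup_right (Submodule.mem_iSup_of_mem _ (Submodule.mem_iSup_of_mem h1 hw))
  obtain ⟨p, hp, q, hq, rfl⟩ := Submodule.mem_sup.mp (htop ▸ Submodule.mem_top : n ∈ _)
  have hq1 : q ∈ (ad ℂ g w).eigenspace 1 := by
    have h1 : p + q ∈ (ad ℂ g w).eigenspace 1 := by
      rwa [Module.End.mem_eigenspace_iff, one_smul, ad_apply]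
    simpa using Submodule.sub_mem _ h1 hp.2
  rw [Submodule.disjoint_def.mp ((ad ℂ g w).eigenspaces_iSupIndep 1) q hq1 hq, add_zero]
  exact hp.1

end LieAlgebra.IsKilling

theorem Complex.exists_re_mul_ne_zero {E : Set ℂ} (hE : E.Finite) :
    ∃ c : ℂ, 0 < c.re ∧ ∀ μ ∈ E, μ ≠ 0 → (c * μ).re ≠ 0 := by
  obtain ⟨δ, hδ⟩ := (hE.image fun μ ↦ μ.re / μ.im).exists_notMem
  refine ⟨⟨1, δ⟩, one_pos, fun μ hμ hμ0 h ↦ ?_⟩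
  rw [Complex.mul_re, one_mul, sub_eq_zero] at h
  by_cases him : μ.im = 0
  · exact hμ0 (Complex.ext (by simpa [him] using h) him)
  · exact hδ ⟨μ, hμ, by simp only [h, mul_div_cancel_right₀ _ him]⟩

open LieAlgebra.IsKilling in
/-- Among the conjugates of `z` in the Cartan subalgebra `H`, one is dominant with respect to
`ζ`. -/
theorem LieEquiv.Lifts.exists_weight_re_nonneg [IsKilling ℂ g] {H : LieSubalgebra ℂ g}
    [H.IsCartanSubalgebra] (V : Type*) [AddCommGroup V] [Module ℂ V] [FiniteDimensional ℂ V]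
    [LieRingModule g V] [LieModule ℂ g V] (ζ : H) {z : g} {φ : g ≃ₗ⁅ℂ⁆ g} (hφ : φ.Lifts V)
    (hz : φ z ∈ H) :
    ∃ ψ : g ≃ₗ⁅ℂ⁆ g, ψ.Lifts V ∧ ∃ w : H, ψ z = w ∧
      ∀ β : Weight ℂ H g, 0 < (β w).re → (β w).im = 0 → 0 ≤ (β ζ).re := by
  set T : Set H := {w | ∃ ψ : g ≃ₗ⁅ℂ⁆ g, ψ.Lifts V ∧ ψ z = w} with hT
  have hfin : T.Finite := by
    refine (finite_setOf_forall_weight_mem (ad ℂ g z).finite_hasEigenvalue).subset ?_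
    rintro w ⟨ψ, -, hψ⟩ β
    obtain ⟨v, hv⟩ := (hasEigenvalue_weight β w).exists_hasEigenvector
    refine Module.End.hasEigenvalue_of_hasEigenvector (x := ψ.symm v)
      ⟨Module.End.mem_eigenspace_iff.mpr ?_, ?_⟩
    · rw [ad_apply]
      apply ψ.injective
      change ψ ⁅z, ψ.symm v⁆ = ψ (β w • ψ.symm v)
      rw [LieEquiv.map_lie, map_smul, hψ, ψ.apply_symm_apply]
      exact hv.apply_eq_smul
    · intro h0
      refine hv.2 ?_
      rw [← ψ.apply_symm_apply v, h0, map_zero]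
  obtain ⟨w, ⟨ψ, hψ, hψw⟩, hmax⟩ := hfin.exists_maximalFor
    (fun w ↦ (traceForm ℂ H g ζ w).re) T ⟨⟨φ z, hz⟩, φ, hφ, rfl⟩
  refine ⟨ψ, hψ, w, hψw, fun β hre him ↦ ?_⟩
  by_contra! hneg
  have hβ : β.IsNonZero := fun h0 ↦ by simp [h0.eq] at hre
  obtain ⟨σ, hσ, hσw⟩ := exists_lifts_apply_eq_sub_smul_coroot V hβ
  obtain ⟨r, hr, hform⟩ := exists_traceForm_coroot_eq hβ
  have key : (traceForm ℂ H g ζ (w - β w • coroot β)).re =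
      (traceForm ℂ H g ζ w).re - (β w).re * (r * (β ζ).re) := by
    rw [map_sub, map_smul, hform]
    simp [him]
  have := hmax (j := w - β w • coroot β)
    ⟨ψ.trans σ, hψ.trans hσ, by rw [LieEquiv.trans_apply, hψw, hσw]⟩
  simp only [key] at this
  have h1 : (β w).re * (r * (β ζ).re) < 0 :=
    mul_neg_of_pos_of_neg hre (mul_neg_of_pos_of_neg hr hneg)
  linarith [this (by linarith)]

end Weyl

theorem dim_fixed_by_regular_centralizer_le_dim_fixed_by_regular_nilpotent_centralizer
    (g : Type*) [LieRing g] [LieAlgebra ℂ g] [FiniteDimensional ℂ g]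
    [LieAlgebra.IsSemisimple ℂ g]
    (e : g) (hrege : IsRegularElement e) (hnile : IsNilpotent ((ad ℂ g) e))
    (x : g) (hregx : IsRegularElement x)
    (V : Type*) [AddCommGroup V] [Module ℂ V] [LieRingModule g V] [LieModule ℂ g V]
    [FiniteDimensional ℂ V] :
    finrank ℂ (annihilatedBy (elementCentralizer ℂ g x) V) ≤
      finrank ℂ (annihilatedBy (elementCentralizer ℂ g e) V) := by
  obtain ⟨h, hh, -, hhe⟩ := IsKilling.exists_isSqRegularElement (s := (0 : g)) (n := e) (zero_lie e)
    (by rw [map_zero]; exact Module.End.isSemisimple_zero) hnile (fun y _ ↦ zero_lie y)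
    (by rwa [zero_add])
  have := hh.isCartanSubalgebra
  set H := elementCentralizer ℂ g h with hH
  have hhH : h ∈ H := mem_elementCentralizer_iff.mpr (lie_self h)
  obtain ⟨c, hc, hcE⟩ := Complex.exists_re_mul_ne_zero (ad ℂ g h).finite_hasEigenvalue
  have hc0 : c ≠ 0 := fun h0 ↦ by simp [h0] at hc
  obtain ⟨s, n, rfl, hsn, hs, hn, hker⟩ := IsKilling.exists_semisimple_add_nilpotent x
  obtain ⟨z, hz, hzs, hzn⟩ := IsKilling.exists_isSqRegularElement hsn hs hn hker hregx
  obtain ⟨φ, hφ, hφH⟩ := hz.exists_lifts V hh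
  have hφz : φ z ∈ H := by
    have : φ z ∈ LinearMap.ker (ad ℂ g h) := hφH ▸ ⟨z, lie_self z, rfl⟩
    exact this
  obtain ⟨ψ, hψ, w, hψw, hdom⟩ := hφ.exists_weight_re_nonneg V (c • ⟨h, hhH⟩ : H) hφz
  rw [← hψ.finrank_annihilatedBy, map_add]
  refine (hh.smul hc0).finrank_annihilatedBy_le V hc (by rw [smul_lie, hhe]) hrege ?_ ?_
    (by rw [← map_add]; exact hregx.map ψ)
  · have hw : ⁅(w : g), ψ s⁆ = 0 := by rw [← hψw, ← LieEquiv.map_lie, hzs, map_zero]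
    have hw' : IsRegularElement (w : g) := hψw ▸ hz.isRegularElement.map ψ
    have : ψ s ∈ LinearMap.ker (ad ℂ g h) :=
      hh.ker_ad_eq_of_isRegularElement (mem_elementCentralizer_iff.mp w.2) hw' ▸ hw
    rw [smul_lie, show ⁅h, ψ s⁆ = 0 from this, smul_zero]
  · have hwn : ⁅(w : g), ψ n⁆ = ψ n := by rw [← hψw, ← LieEquiv.map_lie, hzn]
    have hζ : c • h = (c • (⟨h, hhH⟩ : H) : H) := rfl
    rw [hζ]
    refine IsKilling.mem_posPart_of_forall_weight hwn fun β hβ ↦ ?_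
    have hβ0 : β.IsNonZero := fun h0 ↦ by simp [h0.eq] at hβ
    refine lt_of_le_of_ne (hdom β (by simp [hβ]) (by simp [hβ])) (Ne.symm ?_)
    have := hcE (β ⟨h, hhH⟩) (IsKilling.hasEigenvalue_weight β ⟨h, hhH⟩)
      (IsKilling.weight_apply_ne_zero le_rfl hhH hβ0)
    rwa [← smul_eq_mul, ← Weight.toLinear_apply, ← map_smul] at this

end
end

section
/- Let g be a finite-dimensional complex semisimple Lie algebra with adjoint group G, ℂ[g] its algebra of polynomial functions, and ℂ[g]^G the subalgebra of invariants. Let I ⊂ ℂ[g] be the ideal generated by all G-invariant polynomials with zero constant term (i.e., by the augmentation ideal ℂ[g]^G_+), so that Spec(ℂ[g]/I) is the scheme-theoretic zero fiber of the adjoint quotient map π: g → Spec ℂ[g]^G, whose underlying set is the nilpotent variety of g. Then for every regular nilpotent element e ∈ g, the localization of ℂ[g]/I at the maximal ideal of the point e is a reduced local ring; i.e., the zero fiber π^{-1}(m₀) is reduced at every point of the open orbit of regular nilpotents. -/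
/-!
STATEMENT 7: For a finite-dimensional complex semisimple Lie algebra `g`, let `I ⊆ ℂ[g]` be
the ideal generated by the invariant polynomials with zero constant term, so that
`Spec (ℂ[g]/I)` is the scheme-theoretic zero fiber of the adjoint quotient map.  Then for
every regular nilpotent `e ∈ g`, the localization of `ℂ[g]/I` at the maximal ideal of the
point `e` is a reduced local ring.
-/

noncomputable section

open Module MvPolynomial LieAlgebra

variable (g : Type) [LieRing g] [LieAlgebra ℂ g] [FiniteDimensional ℂ g]

/-- A choice of basis of `g`. -/
def gBasis : Basis (Module.Free.ChooseBasisIndex ℂ g) ℂ g := Module.Free.chooseBasis ℂ g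

/-- The polynomial algebra `ℂ[g]` of polynomial functions on `g`, realized as polynomials in
the coordinate functions of the chosen basis. -/
abbrev PolyAlg := MvPolynomial (Module.Free.ChooseBasisIndex ℂ g) ℂ

/-- Evaluation of a polynomial function at a point `x ∈ g`. -/
def evalAt (x : g) : PolyAlg g →ₐ[ℂ] ℂ :=
  aeval fun i => (gBasis g).coord i x

/-- The action of `y ∈ g` on `ℂ[g]` by the unique derivation extending the coadjoint action
on linear functions. -/
def coadjointDerivation (y : g) : Derivation ℂ (PolyAlg g) (PolyAlg g) :=
  mkDerivation ℂ fun i => - ∑ j, (gBasis g).coord i ⁅y, gBasis g j⁆ • X j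

/-- The subalgebra `ℂ[g]^G` of invariant polynomials: those annihilated by the derivation
action of `g` (for connected `G` this is exactly `G`-invariance). -/
def invariantPolynomials : Subalgebra ℂ (PolyAlg g) where
  carrier := {p | ∀ y : g, coadjointDerivation g y p = 0}
  mul_mem' := fun {a b} ha hb => by
    intro y
    rw [Derivation.leibniz, ha y, hb y, smul_zero, smul_zero, add_zero]
  add_mem' := fun {a b} ha hb => by
    intro y
    rw [map_add, ha y, hb y, add_zero]
  one_mem' := fun y => Derivation.map_one_eq_zero _
  zero_mem' := fun y => map_zero _
  algebraMap_mem' := fun c y => Derivation.map_algebraMap _ c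

/-- The ideal `I ⊆ ℂ[g]` generated by all invariant polynomials with zero constant term;
`Spec (ℂ[g]/I)` is the scheme-theoretic zero fiber of the adjoint quotient map, whose
underlying set is the nilpotent variety of `g`. -/
def zeroFiberIdeal : Ideal (PolyAlg g) :=
  Ideal.span {p : PolyAlg g | p ∈ invariantPolynomials g ∧ constantCoeff p = 0}

/-- The maximal ideal of the point `x ∈ g`, i.e. the polynomials vanishing at `x`. -/
def pointIdeal (x : g) : Ideal (PolyAlg g) := RingHom.ker (evalAt g x)

instance (x : g) : (pointIdeal g x).IsPrime := RingHom.ker_isPrime (evalAt g x)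

section

variable {g}

section NilpotentCommutator

variable {R : Type*} [Ring R] {x y z : R}

theorem pow_succ_mul_eq_of_commute (hz : z = x * y - y * x) (hc : Commute x z) (a : ℕ) :
    x ^ (a + 1) * y = y * x ^ (a + 1) + (a + 1 : ℕ) • (x ^ a * z) := by
  have hxy : x * y = y * x + z := by rw [hz]; abel
  induction a with
  | zero => simp [hxy]
  | succ a ih =>
    rw [pow_succ' x (a + 1), mul_assoc, ih, mul_add, ← mul_assoc, hxy, add_mul, mul_assoc,
      mul_smul_comm, ← mul_assoc x, ← pow_succ', succ_nsmul _ (a + 1),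
      ← pow_succ', (hc.pow_left (a + 1)).eq]
    abel

theorem isNilpotent_commutator_of_commute [IsAddTorsionFree R] (hz : z = x * y - y * x)
    (hc : Commute x z) (hx : IsNilpotent x) : IsNilpotent z := by
  obtain ⟨n, hn⟩ := hx
  have key : ∀ a b, x ^ (a + 1) * z ^ b = 0 → x ^ a * z ^ (2 * b + 1) = 0 := by
    intro a b hab
    have h1 : z ^ b * (x ^ (a + 1) * y) * z ^ b = 0 := by
      rw [← mul_assoc, ← (hc.pow_pow (a + 1) b).eq, hab, zero_mul, zero_mul]
    rw [pow_succ_mul_eq_of_commute hz hc, mul_add, add_mul, mul_assoc (z ^ b), mul_assoc y, hab,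
      mul_zero, mul_zero, zero_add, mul_smul_comm, smul_mul_assoc, ← mul_assoc,
      ← (hc.pow_pow a b).eq, mul_assoc, mul_assoc, ← pow_succ', ← pow_add] at h1
    have h2 := (smul_eq_zero.mp h1).resolve_left (by omega)
    rwa [show 2 * b + 1 = b + (b + 1) by ring]
  have all : ∀ a, ∃ b, x ^ (n - a) * z ^ b = 0 := by
    intro a
    induction a with
    | zero => exact ⟨0, by simp [hn]⟩
    | succ a ih =>
      obtain ⟨b, hb⟩ := ih
      by_cases h : a < n
      · refine ⟨_, key (n - (a + 1)) b ?_⟩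
        rwa [show n - (a + 1) + 1 = n - a by omega]
      · exact ⟨b, by rwa [show n - (a + 1) = n - a by omega]⟩
  obtain ⟨b, hb⟩ := all n
  exact ⟨b, by simpa using hb⟩

theorem isNilpotent_mul_of_commute_commutator [IsAddTorsionFree R] (hz : z = x * y - y * x)
    (hc : Commute x z) (hx : IsNilpotent x) : IsNilpotent (x * y) := by
  obtain ⟨q, hq⟩ := isNilpotent_commutator_of_commute hz hc hx
  obtain ⟨n, hn⟩ := hx
  have key : ∀ a Q, x ^ (a + 1) * (x * y) ^ Q = 0 → x ^ a * (x * y) ^ (Q + q) = 0 := by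
    intro a Q h
    have step : ∀ j, x ^ a * (x * y) ^ (Q + j)
        = (a + 1) ^ j • (z ^ j * (x ^ a * (x * y) ^ Q)) := by
      intro j
      induction j generalizing Q with
      | zero => simp
      | succ j ih =>
        have h' : x ^ (a + 1) * (x * y) ^ (Q + 1) = 0 := by
          rw [pow_succ (x * y), ← mul_assoc, h, zero_mul]
        rw [show Q + (j + 1) = Q + 1 + j by ring, ih (Q + 1) h', pow_succ' (x * y) Q,
          ← mul_assoc (x ^ a), ← mul_assoc (x ^ a), ← pow_succ,
          pow_succ_mul_eq_of_commute hz hc, add_mul, mul_assoc y, h, mul_zero, zero_add,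
          smul_mul_assoc, mul_smul_comm, smul_smul, (hc.pow_left a).eq, mul_assoc z,
          ← mul_assoc (z ^ j), ← pow_succ, ← pow_succ]
    rw [step q, hq, zero_mul, smul_zero]
  have all : ∀ a, ∃ Q, x ^ (n - a) * (x * y) ^ Q = 0 := by
    intro a
    induction a with
    | zero => exact ⟨0, by simp [hn]⟩
    | succ a ih =>
      obtain ⟨b, hb⟩ := ih
      by_cases h : a < n
      · refine ⟨_, key (n - (a + 1)) b ?_⟩
        rwa [show n - (a + 1) + 1 = n - a by omega]
      · exact ⟨b, by rwa [show n - (a + 1) = n - a by omega]⟩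
  obtain ⟨b, hb⟩ := all n
  exact ⟨b, by simpa using hb⟩

end NilpotentCommutator

theorem mem_range_ad_comp_ad_of_isNilpotent [LieAlgebra.IsSemisimple ℂ g] {e : g}
    (hnil : IsNilpotent (ad ℂ g e)) : ∃ w : g, ⁅e, ⁅e, w⁆⁆ = e := by
  by_contra hne
  set p : Submodule ℂ g := LinearMap.range (ad ℂ g e ∘ₗ ad ℂ g e)
  have hep : e ∉ p := fun ⟨w, hw⟩ => hne ⟨w, by simpa using hw⟩
  obtain ⟨f, hfe, hfp⟩ := p.exists_le_ker_of_notMem hep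
  have hnd := LieAlgebra.IsKilling.killingForm_nondegenerate ℂ g
  obtain ⟨z, hz⟩ := (LinearMap.BilinForm.toDual (killingForm ℂ g) hnd).surjective f
  have hz' : ∀ v, killingForm ℂ g z v = f v := fun v => by
    rw [← hz]; exact (LinearMap.BilinForm.toDual_def hnd)
  have inv : ∀ a b c : g, killingForm ℂ g ⁅a, b⁆ c = - killingForm ℂ g b ⁅a, c⁆ := by
    intro a b c
    rw [← lie_skew, map_neg, LinearMap.neg_apply]
    congr 1
    exact LieModule.traceForm_apply_lie_apply ℂ g g b a c
  have hcomm : ⁅e, ⁅e, z⁆⁆ = 0 := by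
    apply (LinearMap.BilinForm.toDual (killingForm ℂ g) hnd).injective
    ext v
    rw [LinearMap.BilinForm.toDual_def, inv, inv, hz', map_zero]
    have : ⁅e, ⁅e, v⁆⁆ ∈ p := ⟨v, rfl⟩
    simpa using hfp this
  apply hfe
  rw [← hz', LieModule.traceForm_comm ℂ g g, killingForm_apply_apply]
  apply IsNilpotent.eq_zero
  apply LinearMap.isNilpotent_trace_of_isNilpotent
  have : IsAddTorsionFree (Module.End ℂ g) :=
    let _ : Module ℚ (Module.End ℂ g) := Module.compHom _ (algebraMap ℚ ℂ)
    .of_module_rat _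
  refine isNilpotent_mul_of_commute_commutator (R := Module.End ℂ g) (z := ad ℂ g ⁅e, z⁆) ?_ ?_ hnil
  · ext v
    simp
  · ext v
    have : ⁅⁅e, ⁅e, z⁆⁆, v⁆ = 0 := by rw [hcomm, zero_lie]
    rw [lie_lie, sub_eq_zero] at this
    simpa using this

section RaisingOperator

variable {V : Type*} [AddCommGroup V] [Module ℂ V] {A B H : Module.End ℂ V}

theorem pow_succ_mul_of_raising (hAB : A * B = B * A + H) (hHA : A * H = H * A - (2 : ℂ) • A)
    (m : ℕ) : A ^ (m + 1) * B = B * A ^ (m + 1) +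
      ((m : ℂ) + 1) • ((H - algebraMap ℂ _ (m : ℂ)) * A ^ m) := by
  induction m with
  | zero => simp [hAB]
  | succ m ih =>
    rw [pow_succ' A (m + 1), mul_assoc, ih, mul_add, ← mul_assoc, hAB, add_mul, mul_assoc,
      mul_smul_comm, ← mul_assoc A, mul_sub, hHA, ← Algebra.commutes (m : ℂ) A, sub_mul, sub_mul,
      sub_mul, smul_mul_assoc, mul_assoc H, mul_assoc _ A, ← pow_succ', ← pow_succ',
      ← Algebra.smul_def, ← Algebra.smul_def]
    push_cast
    module

theorem aeval_prod_apply_pow_eq_zero (hAB : A * B = B * A + H)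
    (hHA : A * H = H * A - (2 : ℂ) • A) (W : Submodule ℂ V) (hWB : ∀ w ∈ W, B w ∈ W) {N : ℕ}
    (hN : ∀ w ∈ W, (A ^ N) w = 0) (k : ℕ) : ∀ m, m + k = N → ∀ c ∈ W, (A ^ (m + 1)) c = 0 →
      Polynomial.aeval H (∏ j ∈ Finset.range k, (Polynomial.X - Polynomial.C ((m + j : ℕ) : ℂ)))
        ((A ^ m) c) = 0 := by
  induction k with
  | zero =>
    rintro m rfl c hc -
    simpa using hN c hc
  | succ k ih =>
    intro m hm c hc h
    have h1 : (A ^ (m + 1)) (B c) =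
        ((m : ℂ) + 1) • (H - algebraMap ℂ (Module.End ℂ V) (m : ℂ)) ((A ^ m) c) := by
      have := LinearMap.congr_fun (pow_succ_mul_of_raising hAB hHA m) c
      simpa [h] using this
    have h2 : (A ^ (m + 2)) (B c) = 0 := by
      have := LinearMap.congr_fun (pow_succ_mul_of_raising hAB hHA (m + 1)) c
      have h' : (A ^ (m + 1 + 1)) c = 0 := by
        rw [pow_succ' A (m + 1), Module.End.mul_apply, h, map_zero]
      simpa [h, h'] using this
    have h3 := ih (m + 1) (by omega) (B c) (hWB c hc) h2
    rw [h1, map_smul, smul_eq_zero] at h3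
    have h4 := h3.resolve_left (by exact_mod_cast m.succ_ne_zero)
    rw [Finset.prod_range_succ', map_mul, Module.End.mul_apply]
    simp only [map_sub, Polynomial.aeval_X, Polynomial.aeval_C, add_zero]
    rw [← h4]
    congr 5
    funext j
    rw [add_assoc, add_comm 1 j]

end RaisingOperator

/-- The linear form `ξ` on `g`, viewed as an element of `ℂ[g]`. -/
def linearForm : Dual ℂ g →ₗ[ℂ] PolyAlg g where
  toFun ξ := ∑ i, ξ (gBasis g i) • X i
  map_add' ξ η := by simp [add_smul, Finset.sum_add_distrib]
  map_smul' c ξ := by simp [mul_smul, Finset.smul_sum]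

theorem linearForm_coord (i : Module.Free.ChooseBasisIndex ℂ g) :
    linearForm ((gBasis g).coord i) = X i := by
  simp [linearForm, Finsupp.single_apply]

theorem linearForm_mem_homogeneousSubmodule (ξ : Dual ℂ g) :
    linearForm ξ ∈ homogeneousSubmodule (Module.Free.ChooseBasisIndex ℂ g) ℂ 1 :=
  Submodule.sum_mem _ fun i _ => Submodule.smul_mem _ _ (isHomogeneous_X ℂ i)

theorem evalAt_linearForm (ξ : Dual ℂ g) (y : g) : evalAt g y (linearForm ξ) = ξ y := by
  conv_rhs => rw [← (gBasis g).sum_repr y, map_sum]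
  simp [linearForm, evalAt, mul_comm]

theorem derivation_ext_linearForm {D D' : Derivation ℂ (PolyAlg g) (PolyAlg g)}
    (h : ∀ ξ : Dual ℂ g, D (linearForm ξ) = D' (linearForm ξ)) : D = D' :=
  MvPolynomial.derivation_ext fun i => by rw [← linearForm_coord]; exact h _

/-- The derivative of polynomial functions on `g` in a constant direction. -/
def directionalDerivation : g →ₗ[ℂ] Derivation ℂ (PolyAlg g) (PolyAlg g) :=
  { toFun v := mkDerivation ℂ fun i => C ((gBasis g).coord i v)
    map_add' v w := MvPolynomial.derivation_ext fun i => by simp [mkDerivation_X]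
    map_smul' c v := MvPolynomial.derivation_ext fun i => by simp [mkDerivation_X, smul_eq_C_mul] }

theorem directionalDerivation_linearForm (v : g) (ξ : Dual ℂ g) :
    directionalDerivation v (linearForm ξ) = C (ξ v) := by
  have h : ∀ i, directionalDerivation v (X i) = C ((gBasis g).coord i v) := fun i => by
    simp [directionalDerivation, mkDerivation_X]
  conv_rhs => rw [← (gBasis g).sum_repr v, map_sum, map_sum]
  simp only [linearForm, LinearMap.coe_mk, AddHom.coe_mk, map_sum, Derivation.map_smul, h]
  simp [smul_eq_C_mul, mul_comm]

theorem coadjointDerivation_linearForm (z : g) (ξ : Dual ℂ g) :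
    coadjointDerivation g z (linearForm ξ) = - linearForm (ξ ∘ₗ (ad ℂ g z : g →ₗ[ℂ] g)) := by
  simp only [linearForm, LinearMap.coe_mk, AddHom.coe_mk, map_sum, Derivation.map_smul,
    coadjointDerivation, mkDerivation_X, LinearMap.comp_apply, ad_apply, smul_neg,
    Finset.sum_neg_distrib, Finset.smul_sum, smul_smul]
  rw [Finset.sum_comm]
  congr 1
  refine Finset.sum_congr rfl fun j _ => ?_
  rw [← Finset.sum_smul]
  congr 1
  conv_rhs => rw [← (gBasis g).sum_repr ⁅z, gBasis g j⁆, map_sum]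
  simp [mul_comm]

theorem coadjointDerivation_add (z w : g) :
    coadjointDerivation g (z + w) = coadjointDerivation g z + coadjointDerivation g w :=
  derivation_ext_linearForm fun ξ => by
    simp only [Derivation.add_apply, coadjointDerivation_linearForm, map_add, LinearMap.comp_add,
      neg_add]

theorem coadjointDerivation_smul (c : ℂ) (z : g) :
    coadjointDerivation g (c • z) = c • coadjointDerivation g z :=
  derivation_ext_linearForm fun ξ => by
    simp only [Derivation.smul_apply, coadjointDerivation_linearForm, map_smul,
      LinearMap.comp_smul, smul_neg]

theorem coadjointDerivation_lie (z w : g) (p : PolyAlg g) :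
    coadjointDerivation g ⁅z, w⁆ p = coadjointDerivation g z (coadjointDerivation g w p) -
      coadjointDerivation g w (coadjointDerivation g z p) := by
  rw [← Derivation.commutator_apply]
  congr 1
  refine derivation_ext_linearForm fun ξ => ?_
  simp only [Derivation.commutator_apply, coadjointDerivation_linearForm,
    ← map_sub, ← map_neg]
  congr 1
  ext v
  simp

theorem directionalDerivation_comm (v w : g) (p : PolyAlg g) :
    directionalDerivation v (directionalDerivation w p) =
      directionalDerivation w (directionalDerivation v p) := by
  rw [← sub_eq_zero, ← Derivation.commutator_apply]
  suffices h : (⁅directionalDerivation v, directionalDerivation w⁆ :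
      Derivation ℂ (PolyAlg g) (PolyAlg g)) = 0 by rw [h, Derivation.zero_apply]
  refine derivation_ext_linearForm fun ξ => ?_
  simp [Derivation.commutator_apply, directionalDerivation_linearForm, ← algebraMap_eq]

theorem coadjointDerivation_directionalDerivation (w v : g) (p : PolyAlg g) :
    coadjointDerivation g w (directionalDerivation v p) =
      directionalDerivation v (coadjointDerivation g w p) + directionalDerivation ⁅w, v⁆ p := by
  rw [← sub_eq_iff_eq_add', ← Derivation.commutator_apply]
  congr 1
  refine derivation_ext_linearForm fun ξ => ?_
  simp [Derivation.commutator_apply, directionalDerivation_linearForm,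
    coadjointDerivation_linearForm, ← algebraMap_eq]

theorem evalAt_coadjointDerivation (y w : g) (p : PolyAlg g) :
    evalAt g y (coadjointDerivation g w p) = - evalAt g y (directionalDerivation ⁅w, y⁆ p) := by
  induction p using MvPolynomial.induction_on with
  | C a => simp [← algebraMap_eq]
  | add p q hp hq => rw [map_add, map_add, hp, hq, map_add, map_add, neg_add]
  | mul_X p i hp =>
    simp only [Derivation.leibniz, map_add, smul_eq_mul, map_mul, hp]
    rw [← linearForm_coord, coadjointDerivation_linearForm, directionalDerivation_linearForm,
      map_neg, evalAt_linearForm, ← algebraMap_eq, AlgHom.commutes]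
    simp only [LinearMap.comp_apply, ad_apply, Algebra.algebraMap_self, RingHom.id_apply]
    ring

theorem derivation_eq_sum_pderiv (D : Derivation ℂ (PolyAlg g) (PolyAlg g)) (p : PolyAlg g) :
    D p = ∑ i, D (X i) * pderiv i p := by
  have hs : ∀ q, (∑ i, D (X i) • pderiv i) q = ∑ i, D (X i) * pderiv i q := fun q => by
    have := congr_fun (map_sum Derivation.coeFnAddMonoidHom (fun i => D (X i) • pderiv i)
      Finset.univ) q
    rw [Finset.sum_apply] at this
    exact this
  have h : D = ∑ i, D (X i) • pderiv i :=
    MvPolynomial.derivation_ext fun j => by rw [hs]; simp [pderiv_X, Pi.single_apply]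
  rw [← hs, ← h]

theorem directionalDerivation_isHomogeneous {p : PolyAlg g} {n : ℕ}
    (hp : p.IsHomogeneous (n + 1)) (v : g) : (directionalDerivation v p).IsHomogeneous n := by
  rw [derivation_eq_sum_pderiv]
  refine IsHomogeneous.sum _ _ _ fun i _ => ?_
  rw [← linearForm_coord, directionalDerivation_linearForm]
  simpa using (isHomogeneous_C _ _).mul (hp.pderiv (i := i))

theorem derivation_eq_zero_of_isHomogeneous_zero (D : Derivation ℂ (PolyAlg g) (PolyAlg g))
    {p : PolyAlg g} (hp : p.IsHomogeneous 0) : D p = 0 := by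
  rw [totalDegree_eq_zero_iff_eq_C.mp ((totalDegree_zero_iff_isHomogeneous _).mpr hp),
    ← algebraMap_eq, Derivation.map_algebraMap]

theorem coadjointDerivation_isHomogeneous {p : PolyAlg g} {n : ℕ}
    (hp : p.IsHomogeneous n) (z : g) : (coadjointDerivation g z p).IsHomogeneous n := by
  rcases n with _ | n
  · rw [derivation_eq_zero_of_isHomogeneous_zero _ hp]
    exact isHomogeneous_zero _ _ _
  rw [derivation_eq_sum_pderiv]
  refine IsHomogeneous.sum _ _ _ fun i _ => ?_
  rw [← linearForm_coord, coadjointDerivation_linearForm, ← map_neg, add_comm n 1]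
  exact (linearForm_mem_homogeneousSubmodule _).mul (by simpa using hp.pderiv (i := i))

theorem Derivation.pow_mul_eq_zero {R S : Type*} [CommRing R] [CommRing S] [Algebra R S]
    (D : Derivation R S S) (n : ℕ) : ∀ (a b : ℕ) (p q : S), a + b ≤ n + 1 →
      ((D : S →ₗ[R] S) ^ a) p = 0 → ((D : S →ₗ[R] S) ^ b) q = 0 →
        ((D : S →ₗ[R] S) ^ n) (p * q) = 0 := by
  induction n with
  | zero =>
    intro a b p q hab hp hq
    rcases Nat.eq_zero_or_pos a with rfl | ha
    · simp_all
    · obtain rfl : b = 0 := by omega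
      simp_all
  | succ n ih =>
    intro a b p q hab hp hq
    rw [pow_succ, Module.End.mul_apply, Derivation.coeFn_coe, Derivation.leibniz, map_add,
      smul_eq_mul, smul_eq_mul]
    have hl : ((D : S →ₗ[R] S) ^ n) (p * D q) = 0 := by
      rcases b with _ | b
      · simp_all
      · exact ih a b p (D q) (by omega) hp (by simpa [pow_succ] using hq)
    have hr : ((D : S →ₗ[R] S) ^ n) (q * D p) = 0 := by
      rcases a with _ | a
      · simp_all
      · exact ih b a q (D p) (by omega) hq (by simpa [pow_succ] using hp)
    rw [hl, hr, add_zero]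

theorem Submodule.exists_pow_apply_eq_zero_of_fg {R M : Type*} [CommRing R] [AddCommGroup M]
    [Module R M] {W : Submodule R M} (hW : W.FG) (T : Module.End R M)
    (hT : ∀ w ∈ W, ∃ n, (T ^ n) w = 0) : ∃ N, ∀ w ∈ W, (T ^ N) w = 0 := by
  obtain ⟨S, rfl⟩ := hW
  choose! n hn using hT
  refine ⟨S.sup n, fun w hw => ?_⟩
  suffices h : Submodule.span R (S : Set M) ≤ LinearMap.ker (T ^ S.sup n) from h hw
  rw [Submodule.span_le]
  intro s hs
  obtain ⟨k, hk⟩ := Nat.exists_eq_add_of_le' (Finset.le_sup (f := n) hs)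
  rw [SetLike.mem_coe, LinearMap.mem_ker, hk, pow_add, Module.End.mul_apply,
    hn s (Submodule.subset_span hs), map_zero]

theorem coadjointDerivation_pow_linearForm (e : g) (n : ℕ) (ξ : Dual ℂ g) :
    ((coadjointDerivation g e : PolyAlg g →ₗ[ℂ] PolyAlg g) ^ n) (linearForm ξ) =
      (-1 : ℂ) ^ n • linearForm (ξ ∘ₗ ((ad ℂ g e : g →ₗ[ℂ] g) ^ n)) := by
  induction n generalizing ξ with
  | zero => simp [Module.End.one_eq_id]
  | succ n ih =>
    rw [pow_succ, Module.End.mul_apply, Derivation.coeFn_coe, coadjointDerivation_linearForm,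
      map_neg, ih, pow_succ (-1 : ℂ), pow_succ' (ad ℂ g e : g →ₗ[ℂ] g), mul_neg_one, neg_smul]
    rfl

theorem exists_coadjointDerivation_pow_eq_zero {e : g} (hnil : IsNilpotent (ad ℂ g e))
    (p : PolyAlg g) :
    ∃ n, ((coadjointDerivation g e : PolyAlg g →ₗ[ℂ] PolyAlg g) ^ n) p = 0 := by
  induction p using MvPolynomial.induction_on with
  | C a => exact ⟨1, by simp [← algebraMap_eq]⟩
  | add p q hp hq =>
    obtain ⟨a, ha⟩ := hp
    obtain ⟨b, hb⟩ := hq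
    refine ⟨a + b, ?_⟩
    rw [map_add, pow_add, Module.End.mul_apply, Module.End.mul_apply, hb, map_zero, add_zero,
      ← Module.End.mul_apply, ← pow_add, add_comm, pow_add, Module.End.mul_apply, ha, map_zero]
  | mul_X p i hp =>
    obtain ⟨a, ha⟩ := hp
    obtain ⟨b, hb⟩ := hnil
    refine ⟨a + b, Derivation.pow_mul_eq_zero _ _ a b p (X i) (by omega) ha ?_⟩
    rw [← linearForm_coord, coadjointDerivation_pow_linearForm, hb]
    simp

theorem exists_aeval_coadjointDerivation_eq_zero {e x h : g} (hnil : IsNilpotent (ad ℂ g e))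
    (hx : ⁅e, x⁆ = h) (he : ⁅h, e⁆ = (2 : ℂ) • e) (k : ℕ) :
    ∃ N : ℕ, ∀ p : PolyAlg g, p.IsHomogeneous k → coadjointDerivation g e p = 0 →
      Polynomial.aeval (coadjointDerivation g h : PolyAlg g →ₗ[ℂ] PolyAlg g)
        (∏ j ∈ Finset.range N, (Polynomial.X - Polynomial.C (j : ℂ))) p = 0 := by
  obtain ⟨N, hN⟩ := Submodule.exists_pow_apply_eq_zero_of_fg
    (homogeneousSubmodule_fg (Module.Free.ChooseBasisIndex ℂ g) ℂ k)
    (coadjointDerivation g e : PolyAlg g →ₗ[ℂ] PolyAlg g)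
    fun p _ => exists_coadjointDerivation_pow_eq_zero hnil p
  refine ⟨N, fun p hp hep => ?_⟩
  have := aeval_prod_apply_pow_eq_zero
    (A := (coadjointDerivation g e : PolyAlg g →ₗ[ℂ] PolyAlg g))
    (B := (coadjointDerivation g x : PolyAlg g →ₗ[ℂ] PolyAlg g))
    (H := (coadjointDerivation g h : PolyAlg g →ₗ[ℂ] PolyAlg g))
    (LinearMap.ext fun q => by
      simp [← hx, coadjointDerivation_lie])
    (LinearMap.ext fun q => by
      have := coadjointDerivation_lie h e q
      rw [he, coadjointDerivation_smul, Derivation.smul_apply] at this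
      simp [this])
    (homogeneousSubmodule (Module.Free.ChooseBasisIndex ℂ g) ℂ k)
    (fun w hw => coadjointDerivation_isHomogeneous hw x) hN N 0 (zero_add N) p hp
    (by simpa using hep)
  simpa using this

section FormalKernel

variable {V : Type*} [AddCommGroup V] [Module ℂ V] [FiniteDimensional ℂ V]

open Filter Topology in
theorem apply_pow_eq_zero_of_eventually (K : V →ₗ[ℂ] V) (z : V) (j : ℕ) : ∀ ψ : Dual ℂ V,
    (∀ᶠ t : ℂ in 𝓝[≠] 0, ∀ v, LinearMap.ker (1 + t • K : Module.End ℂ V) = ⊥ →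
      (1 + t • K : Module.End ℂ V) v = z → ψ v = 0) → ψ ((K ^ j) z) = 0 := by
  classical
  let b := Module.finBasis ℂ V
  let M : ℂ → Matrix _ _ ℂ := fun t => 1 + t • LinearMap.toMatrix b b K
  have hM : ∀ t, M t = LinearMap.toMatrix b b (1 + t • K : Module.End ℂ V) := fun t => by
    simp [M, Module.End.one_eq_id]
  have hMc : Continuous M := by fun_prop
  have hdet : ∀ᶠ t in 𝓝 (0 : ℂ), (M t).det ≠ 0 :=
    hMc.matrix_det.continuousAt.eventually_ne (by simp [M])
  let w : ℂ → V := fun t => b.equivFun.symm ((M t).adjugate.mulVec (b.equivFun z))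
  have hw : ∀ t, (1 + t • K : Module.End ℂ V) (w t) = (M t).det • z := fun t => by
    apply b.equivFun.injective
    have : b.equivFun ((1 + t • K : Module.End ℂ V) (w t)) = (M t).mulVec (b.equivFun (w t)) := by
      rw [hM]; exact (LinearMap.toMatrix_mulVec_repr b b _ (w t)).symm
    rw [this, LinearEquiv.apply_symm_apply, Matrix.mulVec_mulVec, Matrix.mul_adjugate, map_smul,
      Matrix.smul_mulVec, Matrix.one_mulVec]
  have base : ∀ ψ : Dual ℂ V,
      (∀ᶠ t : ℂ in 𝓝[≠] 0, ∀ v, LinearMap.ker (1 + t • K : Module.End ℂ V) = ⊥ →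
        (1 + t • K : Module.End ℂ V) v = z → ψ v = 0) → ψ z = 0 := by
    intro ψ hψ
    have hc : Continuous fun t => ψ (w t) := by
      have h1 : Continuous fun t => (M t).adjugate.mulVec (b.equivFun z) :=
        hMc.matrix_adjugate.matrix_mulVec continuous_const
      exact (LinearMap.continuous_of_finiteDimensional (ψ ∘ₗ b.equivFun.symm.toLinearMap)).comp h1
    have hev : ∀ᶠ t in 𝓝[≠] (0 : ℂ), ψ (w t) = 0 := by
      filter_upwards [hψ, hdet.filter_mono nhdsWithin_le_nhds] with t ht hd
      have hker : LinearMap.ker (1 + t • K : Module.End ℂ V) = ⊥ := by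
        have : IsUnit (LinearMap.toMatrix b b (1 + t • K : Module.End ℂ V)).det := by
          rw [← hM]; exact hd.isUnit
        rw [LinearMap.det_toMatrix] at this
        exact ((LinearMap.isUnit_iff_isUnit_det _).mpr this |>
          (Module.End.isUnit_iff _).mp).injective |> LinearMap.ker_eq_bot.mpr
      have := ht ((M t).det⁻¹ • w t) hker (by rw [map_smul, hw, inv_smul_smul₀ hd])
      rw [map_smul, smul_eq_mul] at this
      exact (mul_eq_zero.mp this).resolve_left (inv_ne_zero hd)
    have h0 : Tendsto (fun t => ψ (w t)) (𝓝[≠] 0) (𝓝 (ψ (w 0))) :=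
      hc.continuousAt.tendsto.mono_left nhdsWithin_le_nhds
    have h1 := tendsto_nhds_unique (h0.congr' hev) tendsto_const_nhds
    have h2 : w 0 = z := by simp [w, M]
    rwa [h2] at h1
  induction j with
  | zero => simpa using base
  | succ j ih =>
    intro ψ hψ
    rw [pow_succ', Module.End.mul_apply]
    refine ih (ψ ∘ₗ K) ?_
    filter_upwards [hψ, self_mem_nhdsWithin] with t ht ht0 v hk hv
    have h1 := congrArg ψ hv
    rw [base ψ hψ, LinearMap.add_apply, map_add, Module.End.one_apply, ht v hk hv, zero_add,
      LinearMap.smul_apply, map_smul, smul_eq_mul] at h1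
    exact (mul_eq_zero.mp h1).resolve_left ht0

theorem exists_formal_kernel_lift (A B : V →ₗ[ℂ] V)
    (hAB : ∀ t : ℂ, finrank ℂ (LinearMap.ker A) ≤ finrank ℂ (LinearMap.ker (A + t • B)))
    {z : V} (hz : A z = 0) :
    ∃ zs : ℕ → V, zs 0 = z ∧ ∀ j, A (zs (j + 1)) + B (zs j) = 0 := by
  obtain ⟨s, hs⟩ := A.rangeRestrict.exists_rightInverse_of_surjective A.range_rangeRestrict
  obtain ⟨S, hS⟩ := LinearMap.exists_extend s
  have hASA : ∀ u ∈ LinearMap.range A, A (S u) = u := fun u hu => by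
    have h1 := congrArg Subtype.val (LinearMap.congr_fun hs ⟨u, hu⟩)
    have h2 : S u = s ⟨u, hu⟩ := LinearMap.congr_fun hS ⟨u, hu⟩
    rw [h2]
    exact h1
  have key : ∀ j, B (((S ∘ₗ B) ^ j) z) ∈ LinearMap.range A := by
    intro j
    by_contra hn
    obtain ⟨φ, hφ, hφA⟩ := (LinearMap.range A).exists_le_ker_of_notMem hn
    refine hφ (apply_pow_eq_zero_of_eventually (S ∘ₗ B) z j (φ ∘ₗ B) ?_)
    filter_upwards [self_mem_nhdsWithin] with t ht v hk hv
    have hmaps : ∀ u ∈ LinearMap.ker (A + t • B),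
        (1 + t • (S ∘ₗ B) : Module.End ℂ V) u ∈ LinearMap.ker A := by
      intro u hu
      have hu' : A u + t • B u = 0 := hu
      have h1 : t • B u = - A u := (neg_eq_of_add_eq_zero_right hu').symm
      have h2 : t • A (S (B u)) = - A u := by
        rw [← map_smul, ← map_smul, h1, map_neg, map_neg, hASA _ ⟨u, rfl⟩]
      simp [h2]
    let f := (1 + t • (S ∘ₗ B) : Module.End ℂ V).restrict hmaps
    have hf : Function.Injective f := fun a b hab =>
      Subtype.ext (LinearMap.ker_eq_bot.mp hk (congrArg Subtype.val hab))
    have hfs : Function.Surjective f :=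
      (LinearMap.injective_iff_surjective_of_finrank_eq_finrank
        (le_antisymm (LinearMap.finrank_le_finrank_of_injective hf) (hAB t))).mp hf
    obtain ⟨u, hu⟩ := hfs ⟨z, hz⟩
    have huv : (u : V) = v := LinearMap.ker_eq_bot.mp hk ((congrArg Subtype.val hu).trans hv.symm)
    have hu2 : A (u : V) + t • B u = 0 := u.2
    rw [huv] at hu2
    have h3 := congrArg φ hu2
    rw [map_add, (hφA ⟨v, rfl⟩ : φ (A v) = 0), zero_add, map_smul, map_zero, smul_eq_mul] at h3
    exact (mul_eq_zero.mp h3).resolve_left ht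
  refine ⟨fun j => (-1 : ℂ) ^ j • ((S ∘ₗ B) ^ j) z, by simp, fun j => ?_⟩
  have h1 : A (((S ∘ₗ B) ^ (j + 1)) z) = B (((S ∘ₗ B) ^ j) z) := by
    rw [pow_succ', Module.End.mul_apply]
    exact hASA _ (key j)
  rw [map_smul, map_smul, h1, pow_succ (-1 : ℂ), mul_neg_one, neg_smul, neg_add_cancel]

end FormalKernel

theorem exists_centralizing_lift {e : g} (hreg : IsRegularElement e) {z : g} (hz : ⁅z, e⁆ = 0)
    (y : g) : ∃ zs : ℕ → g, zs 0 = z ∧ ∀ j, ⁅zs (j + 1), e⁆ + ⁅zs j, y⁆ = 0 := by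
  obtain ⟨zs, h0, h⟩ := exists_formal_kernel_lift (ad ℂ g e : g →ₗ[ℂ] g) (ad ℂ g y)
    (fun t => by
      have h := hreg (e + t • y)
      have h2 : (ad ℂ g e + t • ad ℂ g y : g →ₗ[ℂ] g) = ad ℂ g (e + t • y) := by
        rw [map_add, map_smul]
      rw [h2]
      exact h)
    (z := z) (by rw [ad_apply, ← lie_skew, hz, neg_zero])
  refine ⟨zs, h0, fun j => ?_⟩
  have := h j
  rw [ad_apply, ad_apply, ← lie_skew, ← lie_skew y, ← neg_add, neg_eq_zero] at this
  exact this

theorem coadjointDerivation_eq_zero_of_centralizes {e : g} (hreg : IsRegularElement e)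
    {F : ℕ → PolyAlg g} (hF0 : F 0 = 0) {n : ℕ}
    (hF : ∀ k < n, ∀ z : g, directionalDerivation ⁅z, e⁆ (F (k + 1)) =
      coadjointDerivation g z (F k)) {z : g} (hz : ⁅z, e⁆ = 0) :
    coadjointDerivation g z (F n) = 0 := by
  have heval : ∀ y, evalAt g y (coadjointDerivation g z (F n)) = 0 := by
    intro y
    obtain ⟨zs, h0, h⟩ := exists_centralizing_lift hreg hz y
    have key : ∀ m ≤ n, ∀ j, evalAt g y (directionalDerivation ⁅zs j, y⁆ (F m)) = 0 := by
      intro m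
      induction m with
      | zero => intro _ j; rw [hF0, map_zero, map_zero]
      | succ m ih =>
        intro hm j
        rw [eq_neg_of_add_eq_zero_right (h j), map_neg, Derivation.neg_apply, hF m hm,
          map_neg, evalAt_coadjointDerivation, ih (by omega), neg_zero, neg_zero]
    rw [evalAt_coadjointDerivation, ← h0, key n le_rfl, neg_zero]
  refine MvPolynomial.funext fun x => ?_
  rw [map_zero, ← heval ((gBasis g).equivFun.symm x), evalAt]
  have hx : (fun i => (gBasis g).coord i ((gBasis g).equivFun.symm x)) = x :=
    (gBasis g).equivFun.apply_symm_apply x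
  rw [hx, aeval_eq_eval]

theorem exists_antiderivative {v : g} {ℓ : Dual ℂ g} (hℓ : ℓ v = 1) (n : ℕ) :
    ∀ (m : ℕ) (p : PolyAlg g), p.IsHomogeneous n → ∃ q : PolyAlg g, q.IsHomogeneous (n + m + 1) ∧
      directionalDerivation v q = linearForm ℓ ^ m * p ∧
      ∀ w, ℓ w = 0 → directionalDerivation w p = 0 → directionalDerivation w q = 0 := by
  have hd : ∀ w m (p : PolyAlg g), directionalDerivation w (linearForm ℓ ^ (m + 1) * p) =
      linearForm ℓ ^ (m + 1) * directionalDerivation w p +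
        ((m + 1 : ℕ) : ℂ) • ((ℓ w) • (linearForm ℓ ^ m * p)) := by
    intro w m p
    rw [Derivation.leibniz, Derivation.leibniz_pow, directionalDerivation_linearForm]
    simp only [smul_eq_mul, Nat.add_sub_cancel, nsmul_eq_mul, smul_eq_C_mul, map_natCast]
    ring
  have hL : (linearForm ℓ).IsHomogeneous 1 := linearForm_mem_homogeneousSubmodule ℓ
  have hne : ∀ m : ℕ, ((m + 1 : ℕ) : ℂ) ≠ 0 := fun m => Nat.cast_ne_zero.mpr m.succ_ne_zero
  induction n with
  | zero =>
    intro m p hp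
    refine ⟨((m + 1 : ℕ) : ℂ)⁻¹ • (linearForm ℓ ^ (m + 1) * p), ?_, ?_, ?_⟩
    · refine (homogeneousSubmodule _ ℂ _).smul_mem _ ?_
      rw [mem_homogeneousSubmodule]
      convert (hL.pow (m + 1)).mul hp using 1
      ring
    · rw [Derivation.map_smul, hd, derivation_eq_zero_of_isHomogeneous_zero _ hp, mul_zero,
        zero_add, hℓ, one_smul, inv_smul_smul₀ (hne m)]
    · intro w hw hwp
      rw [Derivation.map_smul, hd, hw, hwp]
      simp
  | succ n ih =>
    intro m p hp
    obtain ⟨q, hq, hvq, hwq⟩ := ih (m + 1) _ (directionalDerivation_isHomogeneous hp v)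
    refine ⟨((m + 1 : ℕ) : ℂ)⁻¹ • (linearForm ℓ ^ (m + 1) * p - q), ?_, ?_, ?_⟩
    · refine (homogeneousSubmodule _ ℂ _).smul_mem _ (Submodule.sub_mem _ ?_ ?_)
      · rw [mem_homogeneousSubmodule]
        convert (hL.pow (m + 1)).mul hp using 1
        ring
      · rw [mem_homogeneousSubmodule]
        convert hq using 1
        ring
    · rw [Derivation.map_smul, map_sub, hd, hvq, add_sub_cancel_left, hℓ, one_smul,
        inv_smul_smul₀ (hne m)]
    · intro w hw hwp
      rw [Derivation.map_smul, map_sub, hd, hw, hwp, hwq w hw]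
      · simp
      · rw [directionalDerivation_comm, hwp, map_zero]

theorem exists_partial_potential {ι : Type*} [DecidableEq ι] (u : ι → g) (η : ι → Dual ℂ g)
    (hη : ∀ i j, η i (u j) = if i = j then 1 else 0) {n : ℕ} (c : ι → PolyAlg g)
    (hc : ∀ i, (c i).IsHomogeneous n)
    (hclosed : ∀ i j, directionalDerivation (u i) (c j) = directionalDerivation (u j) (c i))
    (s : Finset ι) :
    ∃ G : PolyAlg g, G.IsHomogeneous (n + 1) ∧ ∀ i ∈ s, directionalDerivation (u i) G = c i := by
  induction s using Finset.induction_on with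
  | empty => exact ⟨0, isHomogeneous_zero _ _ _, by simp⟩
  | insert a s ha ih =>
    obtain ⟨G, hG, hGs⟩ := ih
    obtain ⟨q, hq, hvq, hwq⟩ := exists_antiderivative (v := u a) (ℓ := η a) (by simp [hη]) n 0
      (c a - directionalDerivation (u a) G)
      (Submodule.sub_mem (homogeneousSubmodule _ ℂ n) (hc a)
        (directionalDerivation_isHomogeneous hG _))
    refine ⟨G + q, hG.add hq, fun i hi => ?_⟩
    rw [map_add]
    rcases Finset.mem_insert.mp hi with rfl | hi
    · rw [hvq, pow_zero, one_mul, add_sub_cancel]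
    · have hia : a ≠ i := fun h => ha (h ▸ hi)
      rw [hGs i hi, hwq, add_zero]
      · simp [hη, hia]
      · rw [map_sub, directionalDerivation_comm, hGs i hi, hclosed, sub_self]

theorem exists_dual_frame (e : g) : ∃ (r : ℕ) (z : Fin r → g) (η : Fin r → Dual ℂ g),
    (∀ i j, η i ⁅z j, e⁆ = if i = j then 1 else 0) ∧
    ∀ w : g, ⁅w, e⁆ = ∑ i, η i ⁅w, e⁆ • ⁅z i, e⁆ := by
  let T : g →ₗ[ℂ] g := -(ad ℂ g e : g →ₗ[ℂ] g)
  have hT : ∀ w, T w = ⁅w, e⁆ := fun w => by simp [T]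
  let b := Module.finBasis ℂ (LinearMap.range T)
  choose z hz using fun i => (b i).2
  choose η hη using fun i => LinearMap.exists_extend (b.coord i)
  have hη' : ∀ i (u : LinearMap.range T), η i u = b.coord i u := fun i u =>
    LinearMap.congr_fun (hη i) u
  refine ⟨_, z, η, fun i j => ?_, fun w => ?_⟩
  · rw [← hT, hz, hη', Basis.coord_apply, b.repr_self, Finsupp.single_apply]
    simp [eq_comm]
  · have h := congrArg Subtype.val (b.sum_repr ⟨T w, w, rfl⟩)
    simp only [AddSubmonoidClass.coe_finsetSum, Submodule.coe_smul] at h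
    rw [← hT, ← h]
    refine Finset.sum_congr rfl fun i _ => ?_
    rw [← hT, hz, h]
    congr 1
    exact (hη' i ⟨T w, w, rfl⟩).symm

/-- The equations expressing, degree by degree up to `n`, that `∑ k, F k`, translated by `e`, is
invariant. -/
def IsTranslatedInvariant (e : g) (F : ℕ → PolyAlg g) (n : ℕ) : Prop :=
  ∀ k < n, ∀ z : g, directionalDerivation ⁅z, e⁆ (F (k + 1)) = coadjointDerivation g z (F k)

theorem IsTranslatedInvariant.closed {e : g} {F : ℕ → PolyAlg g} {n : ℕ}
    (hF : IsTranslatedInvariant e F (n + 1)) (z w : g) :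
    directionalDerivation ⁅z, e⁆ (coadjointDerivation g w (F (n + 1))) =
      directionalDerivation ⁅w, e⁆ (coadjointDerivation g z (F (n + 1))) := by
  have h1 := coadjointDerivation_directionalDerivation w ⁅z, e⁆ (F (n + 1))
  have h2 := coadjointDerivation_directionalDerivation z ⁅w, e⁆ (F (n + 1))
  have h3 := hF n (by omega) ⁅w, z⁆
  rw [hF n (by omega)] at h1 h2
  rw [coadjointDerivation_lie, lie_lie, map_sub, Derivation.sub_apply, h1, h2] at h3
  linear_combination (norm := module) -h3

theorem IsTranslatedInvariant.exists_next {e : g} (hreg : IsRegularElement e)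
    {F : ℕ → PolyAlg g} {n : ℕ} (hF0 : F 0 = 0) (hF : IsTranslatedInvariant e F (n + 1))
    (hhom : (F (n + 1)).IsHomogeneous (n + 1)) :
    ∃ G : PolyAlg g, G.IsHomogeneous (n + 2) ∧
      ∀ z : g, directionalDerivation ⁅z, e⁆ G = coadjointDerivation g z (F (n + 1)) := by
  obtain ⟨r, zs, η, hη, hspan⟩ := exists_dual_frame e
  obtain ⟨G, hG, hGs⟩ := exists_partial_potential (fun i => ⁅zs i, e⁆) η hη
    (fun i => coadjointDerivation g (zs i) (F (n + 1)))
    (fun i => coadjointDerivation_isHomogeneous hhom _) (fun i j => hF.closed _ _) Finset.univ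
  refine ⟨G, hG, fun z => ?_⟩
  let M : g →ₗ[ℂ] PolyAlg g :=
    { toFun w := directionalDerivation ⁅w, e⁆ G - coadjointDerivation g w (F (n + 1))
      map_add' v w := by
        rw [add_lie, map_add, coadjointDerivation_add, Derivation.add_apply, Derivation.add_apply]
        abel
      map_smul' a w := by
        rw [smul_lie, map_smul, coadjointDerivation_smul, Derivation.smul_apply,
          Derivation.smul_apply, RingHom.id_apply, smul_sub] }
  have hz : ⁅z - ∑ i, η i ⁅z, e⁆ • zs i, e⁆ = 0 := by
    rw [sub_lie, sum_lie]
    simp only [smul_lie]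
    rw [← hspan z, sub_self]
  have h0 : M (z - ∑ i, η i ⁅z, e⁆ • zs i) = 0 := by
    change directionalDerivation _ G - coadjointDerivation g _ _ = 0
    rw [coadjointDerivation_eq_zero_of_centralizes hreg hF0 hF hz, hz, map_zero, sub_zero,
      Derivation.zero_apply]
  have hi : ∀ i, M (zs i) = 0 := fun i => sub_eq_zero.mpr (hGs i (Finset.mem_univ i))
  have hM : M z = 0 := by simpa [hi] using h0
  exact sub_eq_zero.mp hM

theorem exists_isTranslatedInvariant {e : g} (hreg : IsRegularElement e) {ξ : Dual ℂ g}
    (hξ : ∀ z : g, ξ ⁅z, e⁆ = 0) (n : ℕ) :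
    ∃ F : ℕ → PolyAlg g, F 0 = 0 ∧ F 1 = linearForm ξ ∧ (∀ k, (F k).IsHomogeneous k) ∧
      IsTranslatedInvariant e F (n + 1) := by
  induction n with
  | zero =>
    refine ⟨fun k => if k = 1 then linearForm ξ else 0, by simp, by simp, fun k => ?_, ?_⟩
    · dsimp only
      split_ifs with h
      · subst h
        exact linearForm_mem_homogeneousSubmodule ξ
      · exact isHomogeneous_zero _ _ _
    · intro k hk z
      obtain rfl : k = 0 := by omega
      simp [directionalDerivation_linearForm, hξ]
  | succ n ih =>
    obtain ⟨F, h0, h1, hhom, hF⟩ := ih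
    obtain ⟨G, hG, hGF⟩ := hF.exists_next hreg h0 (hhom _)
    refine ⟨Function.update F (n + 2) G, ?_, ?_, fun k => ?_, fun k hk z => ?_⟩
    · rw [Function.update_of_ne (by omega), h0]
    · rw [Function.update_of_ne (by omega), h1]
    · rcases eq_or_ne k (n + 2) with rfl | hne
      · rwa [Function.update_self]
      · rw [Function.update_of_ne hne]
        exact hhom k
    · rw [Function.update_of_ne (by omega : k ≠ n + 2)]
      rcases eq_or_ne k (n + 1) with rfl | hne
      · rw [Function.update_self, hGF]
      · rw [Function.update_of_ne (by omega), hF k (by omega)]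

theorem Polynomial.aeval_apply_induction {R M N : Type*} [CommRing R] [AddCommGroup M] [Module R M]
    [AddCommGroup N] [Module R N] (S : Submodule R (M × N)) (T : Module.End R M)
    (T' : Module.End R N) (hS : ∀ a b, (a, b) ∈ S → (T a, T' b) ∈ S) (q : Polynomial R) :
    ∀ a b, (a, b) ∈ S → (Polynomial.aeval T q a, Polynomial.aeval T' q b) ∈ S := by
  induction q using Polynomial.induction_on with
  | C c =>
    intro a b h
    simpa using S.smul_mem c h
  | add p q hp hq =>
    intro a b h
    simpa using S.add_mem (hp a b h) (hq a b h)
  | monomial n c ih =>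
    intro a b h
    have := ih _ _ (hS a b h)
    rw [← Module.End.mul_apply, ← Module.End.mul_apply] at this
    simpa [pow_succ, mul_assoc] using this

/-- The coadjoint action of `h` shifted by `c`. -/
def shiftedCoadjoint (h : g) (c : ℂ) : Module.End ℂ (PolyAlg g) :=
  (coadjointDerivation g h : PolyAlg g →ₗ[ℂ] PolyAlg g) + algebraMap ℂ _ c

theorem shiftedCoadjoint_apply (h : g) (c : ℂ) (p : PolyAlg g) :
    shiftedCoadjoint h c p = coadjointDerivation g h p + c • p := by
  simp [shiftedCoadjoint]

theorem aeval_shiftedCoadjoint_isHomogeneous (h : g) (c : ℂ) (q : Polynomial ℂ) {p : PolyAlg g}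
    {n : ℕ} (hp : p.IsHomogeneous n) :
    (Polynomial.aeval (shiftedCoadjoint h c) q p).IsHomogeneous n := by
  have := Polynomial.aeval_apply_induction ((homogeneousSubmodule _ ℂ n).prod
    (homogeneousSubmodule _ ℂ n)) (shiftedCoadjoint h c) (shiftedCoadjoint h c)
    (fun a b hab => by
      rw [shiftedCoadjoint_apply, shiftedCoadjoint_apply]
      exact ⟨add_mem (coadjointDerivation_isHomogeneous hab.1 h) (Submodule.smul_mem _ c hab.1),
        add_mem (coadjointDerivation_isHomogeneous hab.2 h) (Submodule.smul_mem _ c hab.2)⟩)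
    q p p ⟨hp, hp⟩
  exact this.1

theorem aeval_shiftedCoadjoint_comp (h : g) (c : ℂ) (q : Polynomial ℂ) :
    Polynomial.aeval (shiftedCoadjoint h c) (q.comp (Polynomial.X - Polynomial.C c)) =
      Polynomial.aeval (coadjointDerivation g h : PolyAlg g →ₗ[ℂ] PolyAlg g) q := by
  rw [Polynomial.aeval_comp]
  congr 2
  simp [shiftedCoadjoint]

theorem IsTranslatedInvariant.aeval_shiftedCoadjoint {e h : g} (he : ⁅h, e⁆ = (2 : ℂ) • e)
    {F : ℕ → PolyAlg g} {n : ℕ} (hF : IsTranslatedInvariant e F n) (q : Polynomial ℂ) :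
    IsTranslatedInvariant e
      (fun k => Polynomial.aeval (shiftedCoadjoint h (2 * k)) q (F k)) n := by
  intro k hk
  let S : Submodule ℂ (PolyAlg g × PolyAlg g) :=
    { carrier := {p | ∀ z : g, directionalDerivation ⁅z, e⁆ p.1 = coadjointDerivation g z p.2}
      add_mem' := fun {a b} ha hb z => by
        rw [Prod.fst_add, Prod.snd_add, map_add, map_add, ha, hb]
      zero_mem' := fun z => by rw [Prod.fst_zero, Prod.snd_zero, map_zero, map_zero]
      smul_mem' := fun c a ha z => by
        rw [Prod.smul_fst, Prod.smul_snd, Derivation.map_smul, Derivation.map_smul, ha] }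
  refine Polynomial.aeval_apply_induction S (shiftedCoadjoint h (2 * ((k + 1 : ℕ) : ℂ)))
    (shiftedCoadjoint h (2 * (k : ℂ))) (fun a b hab z => ?_) q _ _ (hF k hk)
  have h1 := coadjointDerivation_directionalDerivation h ⁅z, e⁆ a
  have h2 : directionalDerivation ⁅h, ⁅z, e⁆⁆ a = coadjointDerivation g ⁅h, z⁆ b +
      (2 : ℂ) • coadjointDerivation g z b := by
    rw [leibniz_lie, he, lie_smul, map_add, map_smul, Derivation.add_apply,
      Derivation.smul_apply, hab ⁅h, z⁆, hab z]
  have h3 := coadjointDerivation_lie h z b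
  have h4 : directionalDerivation ⁅z, e⁆ a = coadjointDerivation g z b := hab z
  change directionalDerivation ⁅z, e⁆ (shiftedCoadjoint h _ a) =
    coadjointDerivation g z (shiftedCoadjoint h _ b)
  rw [shiftedCoadjoint_apply, shiftedCoadjoint_apply, map_add, map_add, Derivation.map_smul,
    Derivation.map_smul, h4]
  rw [h2, h3, h4] at h1
  push_cast
  linear_combination (norm := module) -h1

theorem isCoprime_shifted_prod (M N : ℕ) (a b : ℂ)
    (hab : ∀ i < M, ∀ j < N, (i : ℂ) + a ≠ j + b) :
    IsCoprime ((∏ i ∈ Finset.range M, (Polynomial.X - Polynomial.C (i : ℂ))).comp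
        (Polynomial.X - Polynomial.C a))
      ((∏ j ∈ Finset.range N, (Polynomial.X - Polynomial.C (j : ℂ))).comp
        (Polynomial.X - Polynomial.C b)) := by
  rw [Polynomial.prod_comp, Polynomial.prod_comp]
  refine IsCoprime.prod_left fun i hi => IsCoprime.prod_right fun j hj => ?_
  have h : ∀ s t : ℂ, (Polynomial.X - Polynomial.C s).comp (Polynomial.X - Polynomial.C t) =
      Polynomial.X - Polynomial.C (s + t) := fun s t => by
    simp; ring
  rw [h, h]
  exact Polynomial.isCoprime_X_sub_C_of_isUnit_sub
    (sub_ne_zero.mpr (hab i (Finset.mem_range.mp hi) j (Finset.mem_range.mp hj))).isUnit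

theorem exists_truncated_translatedInvariant {e x h : g} (hreg : IsRegularElement e)
    (hnil : IsNilpotent (ad ℂ g e)) (hx : ⁅e, x⁆ = h) (he : ⁅h, e⁆ = (2 : ℂ) • e) {ξ : Dual ℂ g}
    (hξ : ∀ z : g, ξ ⁅z, e⁆ = 0) :
    ∃ (n : ℕ) (F : ℕ → PolyAlg g), F 0 = 0 ∧ F 1 = linearForm ξ ∧ F (n + 1) = 0 ∧
      (∀ k, (F k).IsHomogeneous k) ∧ IsTranslatedInvariant e F (n + 1) := by
  obtain ⟨n, hn⟩ := exists_aeval_coadjointDerivation_eq_zero hnil hx he 1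
  obtain ⟨m, hm⟩ := exists_aeval_coadjointDerivation_eq_zero hnil hx he (n + 1)
  obtain ⟨F, h0, h1, hhom, hF⟩ := exists_isTranslatedInvariant hreg hξ n
  obtain ⟨u, v, huv⟩ := isCoprime_shifted_prod n m (2 * (1 : ℕ)) (2 * (n + 1 : ℕ))
    (fun i hi j _ hij => by
      have : i + 2 * 1 = j + 2 * (n + 1) := by exact_mod_cast hij
      omega)
  set P := ∏ i ∈ Finset.range n, (Polynomial.X - Polynomial.C (i : ℂ))
  set Q := ∏ j ∈ Finset.range m, (Polynomial.X - Polynomial.C (j : ℂ))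
  have hcent : ∀ k ≤ n + 1, coadjointDerivation g e (F k) = 0 := fun k hk =>
    coadjointDerivation_eq_zero_of_centralizes hreg h0 (fun j hj => hF j (by omega)) (lie_self e)
  refine ⟨n, fun k => Polynomial.aeval (shiftedCoadjoint h (2 * k))
    (v * Q.comp (Polynomial.X - Polynomial.C (2 * ((n + 1 : ℕ) : ℂ)))) (F k), ?_, ?_, ?_,
    fun k => aeval_shiftedCoadjoint_isHomogeneous _ _ _ (hhom k), hF.aeval_shiftedCoadjoint he _⟩
  · simp [h0]
  · have := congrArg (fun q => Polynomial.aeval (shiftedCoadjoint h (2 * (1 : ℕ))) q (F 1)) huv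
    dsimp only at this ⊢
    rw [map_add, map_mul _ u, LinearMap.add_apply, Module.End.mul_apply,
      aeval_shiftedCoadjoint_comp, hn _ (hhom 1) (hcent 1 (by omega)), map_zero, zero_add,
      map_one, Module.End.one_apply, h1] at this
    rw [h1, this]
  · dsimp only
    rw [map_mul (Polynomial.aeval _) v, Module.End.mul_apply, aeval_shiftedCoadjoint_comp,
      hm _ (hhom _) (hcent _ le_rfl), map_zero]

theorem aeval_mem_pow_of_isHomogeneous {σ R S : Type*} [CommRing R] [CommRing S]
    [Algebra R S] {J : Ideal S} {x : σ → S} (hx : ∀ i, x i ∈ J) {p : MvPolynomial σ R} {n : ℕ}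
    (hp : p.IsHomogeneous n) : aeval x p ∈ J ^ n := by
  rw [p.as_sum, map_sum]
  refine Ideal.sum_mem _ fun d hd => ?_
  rw [aeval_monomial]
  refine Ideal.mul_mem_left _ _ ?_
  have hdeg : ∑ i ∈ d.support, d i = n := by
    rw [← hp (mem_support_iff.mp hd), Finsupp.weight_apply, Finsupp.sum]
    simp
  rw [← hdeg, ← Finset.prod_pow_eq_pow_sum]
  exact Ideal.prod_mem_prod fun i _ => Ideal.pow_mem_pow (hx i) _

/-- Translation of polynomial functions by `-e`. -/
def translateHom (e : g) : PolyAlg g →ₐ[ℂ] PolyAlg g :=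
  aeval fun i => X i - C ((gBasis g).coord i e)

theorem translateHom_linearForm (e : g) (ξ : Dual ℂ g) :
    translateHom e (linearForm ξ) = linearForm ξ - C (ξ e) := by
  conv_rhs => rw [← (gBasis g).sum_repr e, map_sum, map_sum]
  simp only [linearForm, LinearMap.coe_mk, AddHom.coe_mk, map_sum, ← Finset.sum_sub_distrib,
    map_smul, translateHom, aeval_X]
  refine Finset.sum_congr rfl fun i _ => ?_
  simp [smul_sub, smul_eq_C_mul, mul_comm]

theorem coadjointDerivation_translateHom (e z : g) (p : PolyAlg g) :
    coadjointDerivation g z (translateHom e p) =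
      translateHom e (coadjointDerivation g z p - directionalDerivation ⁅z, e⁆ p) := by
  induction p using MvPolynomial.induction_on with
  | C a => simp [← algebraMap_eq]
  | add p q hp hq => simp only [map_add, hp, hq, map_sub]; abel
  | mul_X p i hp =>
    have hi : coadjointDerivation g z (translateHom e (X i)) =
      translateHom e (coadjointDerivation g z (X i) - directionalDerivation ⁅z, e⁆ (X i)) := by
      rw [← linearForm_coord, translateHom_linearForm, map_sub, coadjointDerivation_linearForm,
        directionalDerivation_linearForm, map_sub, map_neg, translateHom_linearForm,
        ← algebraMap_eq, AlgHom.commutes, Derivation.map_algebraMap]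
      simp
    rw [map_mul, Derivation.leibniz, hi, hp, Derivation.leibniz, Derivation.leibniz]
    simp only [smul_eq_mul, map_sub, map_add, map_mul]
    ring

theorem evalAt_eq_constantCoeff_of_invariant {e h : g} (he : ⁅h, e⁆ = (2 : ℂ) • e) {p : PolyAlg g}
    (hp : coadjointDerivation g h p = 0) : evalAt g e p = constantCoeff p := by
  let φ : PolyAlg g →ₐ[ℂ] Polynomial ℂ :=
    aeval fun i => Polynomial.C ((gBasis g).coord i e) * Polynomial.X
  have hφ : ∀ (t : ℂ) (q : PolyAlg g), (φ q).eval t = evalAt g (t • e) q := fun t q => by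
    rw [← Polynomial.coe_evalRingHom, ← Polynomial.coe_aeval_eq_evalRingHom]
    change ((Polynomial.aeval t).comp φ) q = _
    congr 1
    ext i
    simp only [φ, evalAt, AlgHom.comp_apply, aeval_X, map_mul, Polynomial.aeval_C,
      Polynomial.aeval_X, map_smul, Algebra.algebraMap_self, RingHom.id_apply, smul_eq_mul]
    exact mul_comm _ _
  have hd : ∀ q, Polynomial.derivative (φ q) = φ (directionalDerivation e q) := by
    intro q
    induction q using MvPolynomial.induction_on with
    | C a =>
      rw [← algebraMap_eq, AlgHom.commutes, Derivation.map_algebraMap, map_zero,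
        Polynomial.algebraMap_eq, Polynomial.derivative_C]
    | add p q hp hq => rw [map_add, map_add, hp, hq, map_add, map_add]
    | mul_X p i hp =>
      have hi : Polynomial.derivative (φ (X i)) = φ (directionalDerivation e (X i)) := by
        rw [← linearForm_coord, directionalDerivation_linearForm, linearForm_coord,
          ← algebraMap_eq, AlgHom.commutes]
        simp [φ, Polynomial.algebraMap_eq]
      rw [map_mul, Polynomial.derivative_mul, hi, hp, Derivation.leibniz]
      simp only [smul_eq_mul, map_add, map_mul]
      ring
  have hX : Polynomial.X * Polynomial.derivative (φ p) = 0 := by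
    refine Polynomial.funext fun t => ?_
    have := evalAt_coadjointDerivation (t • e) h p
    rw [hp, map_zero, lie_smul, he, map_smul, map_smul, Derivation.smul_apply,
      Derivation.smul_apply, map_smul, map_smul, ← hφ, ← hd, eq_comm, neg_eq_zero, smul_smul,
      smul_eq_mul] at this
    rw [Polynomial.eval_mul, Polynomial.eval_X, Polynomial.eval_zero]
    rcases mul_eq_zero.mp this with h | h
    · rw [(mul_eq_zero.mp h).resolve_right two_ne_zero, zero_mul]
    · rw [h, mul_zero]
  have hc := Polynomial.eq_C_of_derivative_eq_zero
    ((mul_eq_zero.mp hX).resolve_left Polynomial.X_ne_zero)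
  have h1 := hφ 1 p
  have h0 := hφ 0 p
  rw [hc, Polynomial.eval_C] at h1 h0
  rw [one_smul] at h1
  rw [← h1, h0, zero_smul]
  simp [evalAt, aeval_zero']

theorem exists_sl2_pair [LieAlgebra.IsSemisimple ℂ g] {e : g} (hnil : IsNilpotent (ad ℂ g e)) :
    ∃ x h : g, ⁅e, x⁆ = h ∧ ⁅h, e⁆ = (2 : ℂ) • e := by
  obtain ⟨w, hw⟩ := mem_range_ad_comp_ad_of_isNilpotent hnil
  refine ⟨(-2 : ℂ) • w, _, rfl, ?_⟩
  rw [← lie_skew, lie_smul, lie_smul, hw, neg_smul, neg_neg]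

section TransversalDerivations

variable {K R ι : Type*} [Field K] [CommRing R] [Algebra K R]

theorem Ideal.mul_mem_sup_pow {I J : Ideal R} {a b : ℕ} {x y : R} (hx : x ∈ J ^ a)
    (hy : y ∈ I ⊔ J ^ b) : x * y ∈ I ⊔ J ^ (a + b) := by
  have h := Ideal.mul_mem_mul hx hy
  rw [Ideal.mul_sup, ← pow_add] at h
  exact (sup_le_sup_right Ideal.mul_le_right (J ^ (a + b)) : J ^ a * I ⊔ _ ≤ I ⊔ _) h

theorem Derivation.apply_mem_pow (D : Derivation K R R) (J : Ideal R) {n : ℕ} {x : R}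
    (hx : x ∈ J ^ (n + 1)) : D x ∈ J ^ n := by
  induction n generalizing x with
  | zero => simp
  | succ n ih =>
    rw [pow_succ] at hx
    induction hx using Submodule.mul_induction_on' with
    | mem_mul_mem a ha b hb =>
      rw [Derivation.leibniz, smul_eq_mul, smul_eq_mul, mul_comm b, pow_succ]
      exact add_mem (by rw [← pow_succ]; exact Ideal.mul_mem_right _ _ ha)
        (Ideal.mul_mem_mul (ih ha) hb)
    | add a _ b _ ha hb => rw [map_add]; exact add_mem ha hb

theorem Derivation.apply_mem_sup_pow (D : Derivation K R R) {I J : Ideal R}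
    (hD : ∀ x ∈ I, D x ∈ I) {n : ℕ} {x : R} (hx : x ∈ I ⊔ J ^ (n + 1)) : D x ∈ I ⊔ J ^ n := by
  obtain ⟨a, ha, b, hb, rfl⟩ := Submodule.mem_sup.mp hx
  rw [map_add]
  exact Submodule.add_mem_sup (hD a ha) (D.apply_mem_pow J hb)

theorem Derivation.mvPolynomial_aeval [Fintype ι] (D : Derivation K R R) (L : ι → R)
    (f : MvPolynomial ι K) :
    D (aeval L f) = ∑ j, aeval L (pderiv j f) * D (L j) := by
  classical
  induction f using MvPolynomial.induction_on with
  | C a => simp [← algebraMap_eq]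
  | add p q hp hq => simp only [map_add, hp, hq, add_mul, Finset.sum_add_distrib]
  | mul_X p i hp =>
    simp only [map_mul, aeval_X, Derivation.leibniz, hp, pderiv_X, smul_eq_mul, map_add, add_mul,
      Finset.sum_add_distrib, Finset.mul_sum]
    have hs : ∀ j, aeval L (Pi.single (M := fun _ => MvPolynomial ι K) j 1 i) =
        if i = j then 1 else 0 := fun j => by rw [Pi.single_apply]; split_ifs <;> simp
    simp only [hs, ite_mul, zero_mul, mul_ite, mul_zero, mul_one, Finset.sum_ite_eq,
      Finset.mem_univ, if_true, mul_assoc]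

variable {φ : R →ₐ[K] K} {I : Ideal R} {L : ι → R}

theorem exists_isHomogeneous_aeval_sub_mem [Fintype ι] (hL : ∀ i, L i ∈ RingHom.ker φ)
    (hgen : ∀ b ∈ RingHom.ker φ, ∃ c : ι → K, b - ∑ i, c i • L i ∈ I ⊔ RingHom.ker φ ^ 2)
    {k : ℕ} {a : R} (ha : a ∈ RingHom.ker φ ^ k) :
    ∃ f : MvPolynomial ι K, f.IsHomogeneous k ∧ a - aeval L f ∈ I ⊔ RingHom.ker φ ^ (k + 1) := by
  induction k generalizing a with
  | zero =>
    refine ⟨C (φ a), isHomogeneous_C _ _, Submodule.mem_sup_right ?_⟩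
    rw [zero_add, pow_one, RingHom.mem_ker, ← algebraMap_eq, AlgHom.commutes, map_sub,
      AlgHom.commutes, Algebra.algebraMap_self, RingHom.id_apply, sub_self]
  | succ k ih =>
    rw [pow_succ] at ha
    induction ha using Submodule.mul_induction_on' with
    | mem_mul_mem a ha b hb =>
      obtain ⟨f, hf, haf⟩ := ih ha
      obtain ⟨c, hc⟩ := hgen b hb
      refine ⟨f * ∑ i, c i • X i, hf.mul (IsHomogeneous.sum _ _ _ fun i _ => ?_), ?_⟩
      · exact (homogeneousSubmodule ι K 1).smul_mem _ (isHomogeneous_X K i)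
      have h1 := Ideal.mul_mem_sup_pow (aeval_mem_pow_of_isHomogeneous hL hf) hc
      have h2 := Ideal.mul_mem_sup_pow (a := 1) (by rwa [pow_one]) haf
      rw [show k + 2 = k + 1 + 1 from rfl] at h1
      rw [show 1 + (k + 1) = k + 1 + 1 by omega] at h2
      convert add_mem h1 h2 using 1
      simp only [map_mul, map_sum, map_smul, aeval_X]
      ring
    | add a _ b _ ha hb =>
      obtain ⟨f, hf, haf⟩ := ha
      obtain ⟨f', hf', hbf⟩ := hb
      refine ⟨f + f', hf.add hf', ?_⟩
      rw [map_add, add_sub_add_comm]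
      exact add_mem haf hbf

theorem eq_zero_of_aeval_mem_sup_pow [CharZero K] [Fintype ι] [DecidableEq ι]
    (hI : I ≤ RingHom.ker φ) (hL : ∀ i, L i ∈ RingHom.ker φ) {D : ι → Derivation K R R}
    (hDI : ∀ i, ∀ x ∈ I, D i x ∈ I)
    (hDL : ∀ i j, D i (L j) - (if i = j then 1 else 0) ∈ RingHom.ker φ)
    {k : ℕ} {f : MvPolynomial ι K} (hf : f.IsHomogeneous k)
    (hfL : aeval L f ∈ I ⊔ RingHom.ker φ ^ (k + 1)) : f = 0 := by
  induction k generalizing f with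
  | zero =>
    rw [totalDegree_eq_zero_iff_eq_C.mp ((totalDegree_zero_iff_isHomogeneous _).mpr hf)] at hfL ⊢
    rw [zero_add, pow_one, sup_eq_right.mpr hI, RingHom.mem_ker, ← algebraMap_eq, AlgHom.commutes,
      AlgHom.commutes, Algebra.algebraMap_self, RingHom.id_apply] at hfL
    rw [hfL, map_zero]
  | succ k ih =>
    have hp : ∀ i, pderiv i f = 0 := fun i => by
      refine ih (hf.pderiv (i := i)) ?_
      have h1 := (D i).apply_mem_sup_pow (hDI i) hfL
      have h2 : ∑ j, aeval L (pderiv j f) * (D i (L j) - (if i = j then 1 else 0)) ∈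
          I ⊔ RingHom.ker φ ^ (k + 1) := by
        refine Submodule.mem_sup_right (Ideal.sum_mem _ fun j _ => ?_)
        rw [pow_succ]
        exact Ideal.mul_mem_mul (aeval_mem_pow_of_isHomogeneous hL (hf.pderiv (i := j))) (hDL i j)
      convert sub_mem h1 h2 using 1
      rw [Derivation.mvPolynomial_aeval]
      simp [mul_sub]
    have := hf.sum_X_mul_pderiv
    simp only [hp, mul_zero, Finset.sum_const_zero] at this
    exact (smul_eq_zero.mp this.symm).resolve_left (Nat.succ_ne_zero k)

theorem Ideal.pow_sub_pow_mem {J : Ideal R} {k : ℕ} {x y : R} (hx : x ∈ J ^ k) (hy : y ∈ J ^ k)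
    (hxy : x - y ∈ J ^ (k + 1)) (n : ℕ) : x ^ n - y ^ n ∈ J ^ (k * n + 1) := by
  induction n with
  | zero => simp
  | succ n ih =>
    have h1 := Ideal.mul_mem_mul (Ideal.pow_mem_pow hx n) hxy
    have h2 := Ideal.mul_mem_mul ih hy
    rw [← pow_mul, ← pow_add] at h1
    rw [← pow_add] at h2
    rw [show k * (n + 1) + 1 = k * n + (k + 1) by ring]
    rw [show k * n + 1 + k = k * n + (k + 1) by ring] at h2
    convert add_mem h1 h2 using 1
    ring

theorem mem_sup_pow_of_mul_pow_mem [CharZero K] [Fintype ι] [DecidableEq ι]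
    (hI : I ≤ RingHom.ker φ) (hL : ∀ i, L i ∈ RingHom.ker φ)
    (hgen : ∀ b ∈ RingHom.ker φ, ∃ c : ι → K, b - ∑ i, c i • L i ∈ I ⊔ RingHom.ker φ ^ 2)
    {D : ι → Derivation K R R} (hDI : ∀ i, ∀ x ∈ I, D i x ∈ I)
    (hDL : ∀ i j, D i (L j) - (if i = j then 1 else 0) ∈ RingHom.ker φ)
    {t a : R} {n : ℕ} (ht : t ∉ RingHom.ker φ) (hta : t * a ^ n ∈ I) (k : ℕ) :
    a ∈ I ⊔ RingHom.ker φ ^ k := by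
  have hpow : ∀ N, a ^ n ∈ I ⊔ RingHom.ker φ ^ N := fun N => by
    set s := algebraMap K R (φ t)⁻¹ with hs
    have hst : 1 - s * t ∈ RingHom.ker φ := by
      rw [RingHom.mem_ker] at ht ⊢
      rw [map_sub, map_one, map_mul, hs, AlgHom.commutes, Algebra.algebraMap_self,
        RingHom.id_apply, inv_mul_cancel₀ ht, sub_self]
    obtain ⟨u, hu⟩ := sub_dvd_pow_sub_pow 1 (1 - s * t) N
    rw [one_pow] at hu
    have : a ^ n = s * u * (t * a ^ n) + (1 - s * t) ^ N * a ^ n := by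
      linear_combination a ^ n * hu
    rw [this]
    exact Submodule.add_mem_sup (Ideal.mul_mem_left _ _ hta)
      (Ideal.mul_mem_right _ _ (Ideal.pow_mem_pow hst N))
  induction k with
  | zero => simp
  | succ k ih =>
    obtain ⟨i, hi, b, hb, rfl⟩ := Submodule.mem_sup.mp ih
    obtain ⟨f, hf, hbf⟩ := exists_isHomogeneous_aeval_sub_mem hL hgen hb
    obtain ⟨j, hj, c, hc, hjc⟩ := Submodule.mem_sup.mp hbf
    have hfk := aeval_mem_pow_of_isHomogeneous hL hf
    have hck := Ideal.pow_le_pow_right (Nat.le_succ k) hc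
    have h1 : (aeval L f + c) ^ n - (i + b) ^ n ∈ I := by
      refine Ideal.mem_of_dvd I (sub_dvd_pow_sub_pow _ _ n) ?_
      rw [show aeval L f + c - (i + b) = -(j + i) by linear_combination hjc]
      exact neg_mem (add_mem hj hi)
    have h2 := Ideal.pow_sub_pow_mem hfk (add_mem hfk hck)
      (by rw [sub_add_cancel_left]; exact neg_mem hc) n
    have h3 : aeval L (f ^ n) ∈ I ⊔ RingHom.ker φ ^ (k * n + 1) := by
      rw [map_pow]
      convert add_mem (hpow (k * n + 1)) (Submodule.add_mem_sup h1 h2) using 1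
      ring
    have hf0 : f = 0 := eq_zero_of_pow_eq_zero
      (eq_zero_of_aeval_mem_sup_pow hI hL hDI hDL (hf.pow n) h3)
    rw [hf0, map_zero, sub_zero] at hbf
    exact add_mem (Submodule.mem_sup_left hi) hbf

theorem IsLocalRing.localization_quotient {P : Ideal R} [P.IsPrime] (hI : I ≤ P) :
    IsLocalRing (Localization.AtPrime P ⧸ I.map (algebraMap R (Localization.AtPrime P))) := by
  have hne : I.map (algebraMap R (Localization.AtPrime P)) ≠ ⊤ := fun h => by
    have := Ideal.map_mono (f := algebraMap R (Localization.AtPrime P)) hI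
    rw [h, Localization.AtPrime.map_eq_maximalIdeal, top_le_iff] at this
    exact (IsLocalRing.maximalIdeal.isMaximal _).ne_top this
  have := Ideal.Quotient.nontrivial_iff.mpr hne
  exact IsLocalRing.of_surjective' (Ideal.Quotient.mk _) Ideal.Quotient.mk_surjective

theorem IsReduced.localization_quotient [IsNoetherianRing R] {P : Ideal R} [P.IsPrime]
    (hI : I ≤ P) (h : ∀ (t a : R) (n : ℕ), t ∉ P → t * a ^ n ∈ I → ∀ k, a ∈ I ⊔ P ^ k) :
    IsReduced (Localization.AtPrime P ⧸ I.map (algebraMap R (Localization.AtPrime P))) := by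
  have := IsLocalRing.localization_quotient hI
  set O := Localization.AtPrime P
  set π := Ideal.Quotient.mk (I.map (algebraMap R O))
  have hπ : Function.Surjective π := Ideal.Quotient.mk_surjective
  have hloc : IsLocalHom π := IsLocalHom.of_surjective π hπ
  have hmax : (IsLocalRing.maximalIdeal O).map π ≤ IsLocalRing.maximalIdeal _ :=
    ((IsLocalRing.local_hom_TFAE π).out 0 2).mp hloc
  refine ⟨fun x ⟨n, hn⟩ => ?_⟩
  obtain ⟨b, rfl⟩ := hπ x
  obtain ⟨a, s, rfl⟩ := IsLocalization.exists_mk'_eq P.primeCompl b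
  have hunit : ∀ y : O, y * algebraMap R O s ∈ I.map (algebraMap R O) ↔
      y ∈ I.map (algebraMap R O) := fun y =>
    Ideal.mul_unit_mem_iff_mem _ (IsLocalization.map_units O s)
  have ha : algebraMap R O (a ^ n) ∈ I.map (algebraMap R O) := by
    rw [← map_pow, Ideal.Quotient.eq_zero_iff_mem] at hn
    rw [map_pow, ← IsLocalization.mk'_spec O a s, mul_pow]
    exact Ideal.mul_mem_right _ _ hn
  obtain ⟨t, ht, hta⟩ := (IsLocalization.algebraMap_mem_map_algebraMap_iff P.primeCompl O _ _).mp ha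
  have hk : π (algebraMap R O a) ∈
      ⨅ k : ℕ, IsLocalRing.maximalIdeal (O ⧸ I.map (algebraMap R O)) ^ k := by
    refine (Ideal.mem_iInf).mpr fun k => ?_
    obtain ⟨i, hi, c, hc, rfl⟩ := Submodule.mem_sup.mp (h t a n ht hta k)
    rw [map_add, map_add, Ideal.Quotient.eq_zero_iff_mem.mpr (Ideal.mem_map_of_mem _ hi), zero_add]
    refine Ideal.pow_right_mono hmax k ?_
    rw [← Ideal.map_pow, ← Localization.AtPrime.map_eq_maximalIdeal, ← Ideal.map_pow]
    exact Ideal.mem_map_of_mem _ (Ideal.mem_map_of_mem _ hc)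
  rw [Ideal.iInf_pow_eq_bot_of_isLocalRing _ (IsLocalRing.maximalIdeal.isMaximal _).ne_top,
    Ideal.mem_bot, Ideal.Quotient.eq_zero_iff_mem, ← IsLocalization.mk'_spec O a s, hunit] at hk
  exact Ideal.Quotient.eq_zero_iff_mem.mpr hk

end TransversalDerivations

theorem zeroFiberIdeal_le_pointIdeal {e h : g} (he : ⁅h, e⁆ = (2 : ℂ) • e) :
    zeroFiberIdeal g ≤ pointIdeal g e :=
  Ideal.span_le.mpr fun p hp => by
    change evalAt g e p = 0
    rw [evalAt_eq_constantCoeff_of_invariant he (hp.1 h), hp.2]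

theorem coadjointDerivation_mem_zeroFiberIdeal (z : g) {p : PolyAlg g}
    (hp : p ∈ zeroFiberIdeal g) : coadjointDerivation g z p ∈ zeroFiberIdeal g := by
  induction hp using Submodule.span_induction with
  | mem p hp => rw [hp.1 z]; exact zero_mem _
  | zero => rw [map_zero]; exact zero_mem _
  | add p q _ _ hp hq => rw [map_add]; exact add_mem hp hq
  | smul a p hp ih =>
    rw [smul_eq_mul, Derivation.leibniz]
    exact add_mem (Ideal.mul_mem_left _ _ ih) (Ideal.mul_mem_right _ _ hp)

theorem translateHom_mem_pointIdeal_pow (e : g) {p : PolyAlg g} {n : ℕ} (hp : p.IsHomogeneous n) :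
    translateHom e p ∈ pointIdeal g e ^ n :=
  aeval_mem_pow_of_isHomogeneous (fun i => by
    rw [pointIdeal, RingHom.mem_ker]
    simp [evalAt]) hp

theorem linearForm_sub_mem_zeroFiberIdeal_sup {e x h : g} (hreg : IsRegularElement e)
    (hnil : IsNilpotent (ad ℂ g e)) (hx : ⁅e, x⁆ = h) (he : ⁅h, e⁆ = (2 : ℂ) • e) {ξ : Dual ℂ g}
    (hξ : ∀ z : g, ξ ⁅z, e⁆ = 0) :
    linearForm ξ - C (ξ e) ∈ zeroFiberIdeal g ⊔ pointIdeal g e ^ 2 := by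
  obtain ⟨n, F, h0, h1, hlast, hhom, hF⟩ := exists_truncated_translatedInvariant hreg hnil hx he hξ
  set P := ∑ k ∈ Finset.range (n + 1), F (k + 1) with hP
  have hinv : ∀ z, directionalDerivation ⁅z, e⁆ P = coadjointDerivation g z P := fun z => by
    rw [hP, map_sum, Finset.sum_congr rfl fun k hk => hF k (Finset.mem_range.mp hk) z, map_sum,
      Finset.sum_range_succ', Finset.sum_range_succ, h0, hlast]
  have hmem : ∀ k, translateHom e (F (k + 1)) ∈ pointIdeal g e ^ (k + 1) := fun k =>
    translateHom_mem_pointIdeal_pow e (hhom _)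
  have hI : translateHom e P ∈ zeroFiberIdeal g := by
    have hzero : ∀ z, coadjointDerivation g z (translateHom e P) = 0 := fun z => by
      rw [coadjointDerivation_translateHom, hinv, sub_self, map_zero]
    refine Ideal.subset_span ⟨hzero, ?_⟩
    rw [← evalAt_eq_constantCoeff_of_invariant he (hzero h)]
    change translateHom e P ∈ pointIdeal g e
    rw [hP, map_sum]
    exact Ideal.sum_mem _ fun k _ => Ideal.pow_le_self (Nat.succ_ne_zero k) (hmem k)
  have hrest : ∑ k ∈ Finset.range n, translateHom e (F (k + 1 + 1)) ∈ pointIdeal g e ^ 2 :=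
    Ideal.sum_mem _ fun k _ => Ideal.pow_le_pow_right (by omega) (hmem (k + 1))
  convert Submodule.add_mem_sup hI (neg_mem hrest) using 1
  rw [hP, map_sum, Finset.sum_range_succ', zero_add, h1, translateHom_linearForm]
  ring

theorem linearForm_sub_mem_pointIdeal (e : g) (ξ : Dual ℂ g) :
    linearForm ξ - C (ξ e) ∈ pointIdeal g e := by
  rw [pointIdeal, RingHom.mem_ker, map_sub, evalAt_linearForm, ← algebraMap_eq, AlgHom.commutes,
    Algebra.algebraMap_self, RingHom.id_apply, sub_self]

theorem exists_sub_linearForm_mem_sq (e : g) (b : PolyAlg g) :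
    ∃ η : Dual ℂ g, b - C (evalAt g e b) - (linearForm η - C (η e)) ∈ pointIdeal g e ^ 2 := by
  induction b using MvPolynomial.induction_on with
  | C a =>
    refine ⟨0, ?_⟩
    rw [← algebraMap_eq, AlgHom.commutes]
    simp
  | add p q hp hq =>
    obtain ⟨η, hη⟩ := hp
    obtain ⟨θ, hθ⟩ := hq
    refine ⟨η + θ, ?_⟩
    convert add_mem hη hθ using 1
    simp only [map_add, LinearMap.add_apply]
    ring
  | mul_X p i hp =>
    obtain ⟨η, hη⟩ := hp
    refine ⟨evalAt g e p • (gBasis g).coord i + (gBasis g).coord i e • η, ?_⟩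
    have hm := Ideal.mul_mem_mul (linearForm_sub_mem_pointIdeal e η)
      (linearForm_sub_mem_pointIdeal e ((gBasis g).coord i))
    rw [← pow_two] at hm
    convert add_mem hm (Ideal.mul_mem_right (X i) _ hη) using 1
    have hX : evalAt g e (X i) = (gBasis g).coord i e := aeval_X _ i
    simp only [map_mul, map_add, map_smul, linearForm_coord, hX, LinearMap.add_apply,
      LinearMap.smul_apply, smul_eq_C_mul, smul_eq_mul]
    ring

theorem exists_sub_sum_mem_zeroFiberIdeal_sup {e x h : g} (hreg : IsRegularElement e)
    (hnil : IsNilpotent (ad ℂ g e)) (hx : ⁅e, x⁆ = h) (he : ⁅h, e⁆ = (2 : ℂ) • e)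
    {r : ℕ} {z : Fin r → g} {η : Fin r → Dual ℂ g}
    (hη : ∀ i j, η i ⁅z j, e⁆ = if i = j then 1 else 0)
    (hspan : ∀ w : g, ⁅w, e⁆ = ∑ i, η i ⁅w, e⁆ • ⁅z i, e⁆)
    {b : PolyAlg g} (hb : b ∈ pointIdeal g e) :
    ∃ c : Fin r → ℂ, b - ∑ i, c i • (linearForm (η i) - C (η i e)) ∈
      zeroFiberIdeal g ⊔ pointIdeal g e ^ 2 := by
  obtain ⟨ζ, hζ⟩ := exists_sub_linearForm_mem_sq e b
  rw [(RingHom.mem_ker.mp hb : evalAt g e b = 0), map_zero, sub_zero] at hζ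
  refine ⟨fun i => ζ ⁅z i, e⁆, ?_⟩
  have := linearForm_sub_mem_zeroFiberIdeal_sup hreg hnil hx he
    (ξ := ζ - ∑ i, ζ ⁅z i, e⁆ • η i) fun w => by
      rw [hspan w, map_sum]
      refine Finset.sum_eq_zero fun i _ => ?_
      simp [hη]
  convert add_mem (Submodule.mem_sup_right hζ) this using 1
  simp only [map_sub, map_sum, map_smul, LinearMap.sub_apply, LinearMap.sum_apply,
    LinearMap.smul_apply, smul_sub, Finset.sum_sub_distrib, smul_eq_C_mul, smul_eq_mul, map_mul]
  ring

theorem mem_zeroFiberIdeal_sup_pow_of_mul_pow_mem [LieAlgebra.IsSemisimple ℂ g]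
    {e : g} (hreg : IsRegularElement e) (hnil : IsNilpotent (ad ℂ g e)) {t a : PolyAlg g} {n : ℕ}
    (ht : t ∉ pointIdeal g e) (hta : t * a ^ n ∈ zeroFiberIdeal g) (k : ℕ) :
    a ∈ zeroFiberIdeal g ⊔ pointIdeal g e ^ k := by
  obtain ⟨x, h, hx, he⟩ := exists_sl2_pair hnil
  obtain ⟨r, z, η, hη, hspan⟩ := exists_dual_frame e
  refine mem_sup_pow_of_mul_pow_mem (φ := evalAt g e)
    (L := fun i => linearForm (η i) - C (η i e)) (D := fun i => -coadjointDerivation g (z i))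
    (zeroFiberIdeal_le_pointIdeal he) (fun i => linearForm_sub_mem_pointIdeal e (η i))
    (fun b hb => exists_sub_sum_mem_zeroFiberIdeal_sup hreg hnil hx he hη hspan hb)
    (fun i p hp => neg_mem (coadjointDerivation_mem_zeroFiberIdeal (z i) hp))
    (fun i j => ?_) ht hta k
  rw [RingHom.mem_ker, map_sub, Derivation.neg_apply, map_sub (coadjointDerivation g (z i)),
    ← algebraMap_eq, Derivation.map_algebraMap, sub_zero, coadjointDerivation_linearForm, neg_neg,
    evalAt_linearForm, LinearMap.comp_apply]
  change η j ⁅z i, e⁆ - _ = 0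
  rw [hη]
  rcases eq_or_ne i j with rfl | hij
  · rw [if_pos rfl, if_pos rfl, map_one, sub_self]
  · rw [if_neg hij, if_neg hij.symm, map_zero, sub_self]

end

theorem zero_fiber_reduced_at_regular_nilpotent [LieAlgebra.IsSemisimple ℂ g]
    (e : g) (hreg : IsRegularElement e) (hnil : IsNilpotent ((ad ℂ g) e)) :
    IsLocalRing (Localization.AtPrime (pointIdeal g e) ⧸
      (zeroFiberIdeal g).map
        (algebraMap (PolyAlg g) (Localization.AtPrime (pointIdeal g e)))) ∧
    IsReduced (Localization.AtPrime (pointIdeal g e) ⧸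
      (zeroFiberIdeal g).map
        (algebraMap (PolyAlg g) (Localization.AtPrime (pointIdeal g e)))) := by
  obtain ⟨x, h, hx, he⟩ := exists_sl2_pair hnil
  have hle := zeroFiberIdeal_le_pointIdeal he
  exact ⟨IsLocalRing.localization_quotient hle, IsReduced.localization_quotient hle
    fun t a n ht hta k => mem_zeroFiberIdeal_sup_pow_of_mul_pow_mem hreg hnil ht hta k⟩

end
end
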